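/- arXiv:2210.04550 — 3 statements merged into one kernel-verified Lean document; each statement's English description precedes it below -/
import Mathlib

section
/- Let n be a positive odd integer with n ≥ 232, n ≡ 4 (mod 5) and n ≡ 2 (mod 3). Then for every finite abelian group H of order n²+n+1 there exist no inverse-closed subsets T₀, T₁ of H with e ∈ T₀ satisfying the APLL group-ring equations. -/
open scoped Classical Pointwise

/-- The APLL group-ring equations, stated via coefficient counts: for every `h ∈ H`,
`#{(a,b) ∈ T₀×T₁ : ab = h} = 1 − [h = e]`, and
`#{(a,b) ∈ T₀×T₀ : ab = h} + #{(a,b) ∈ T₁×T₁ : ab = h} + #{t ∈ T₀ : t² = h}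
  + #{t ∈ T₁ : t² = h} = 2 + 2n·[h = e]`. -/
def APLLEqs {H : Type*} [CommGroup H] (n : ℕ) (T₀ T₁ : Set H) : Prop :=
  (∀ h : H,
      {p : H × H | p.1 ∈ T₀ ∧ p.2 ∈ T₁ ∧ p.1 * p.2 = h}.ncard
        = if h = 1 then 0 else 1) ∧
  (∀ h : H,
      {p : H × H | p.1 ∈ T₀ ∧ p.2 ∈ T₀ ∧ p.1 * p.2 = h}.ncard
        + {p : H × H | p.1 ∈ T₁ ∧ p.2 ∈ T₁ ∧ p.1 * p.2 = h}.ncard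
        + {t : H | t ∈ T₀ ∧ t ^ 2 = h}.ncard
        + {t : H | t ∈ T₁ ∧ t ^ 2 = h}.ncard
        = 2 + if h = 1 then 2 * n else 0)

/-- `Xset T₀ T₁ i` is the set of `h ∈ H` appearing with coefficient `i` in `T̂⁽²⁾T₀`. -/
def Xset {H : Type*} [CommGroup H] (T₀ T₁ : Set H) (i : ℕ) : Set H :=
  {h : H | {p : H × H | p.1 ∈ T₀ ∪ T₁ ∧ p.2 ∈ T₀ ∧ p.1 ^ 2 * p.2 = h}.ncard = i}

/-- `Yset T₀ T₁ i` is the set of `h ∈ H` appearing with coefficient `i` in `T̂⁽²⁾T₁`. -/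
def Yset {H : Type*} [CommGroup H] (T₀ T₁ : Set H) (i : ℕ) : Set H :=
  {h : H | {p : H × H | p.1 ∈ T₀ ∪ T₁ ∧ p.2 ∈ T₁ ∧ p.1 ^ 2 * p.2 = h}.ncard = i}

/-- `Vset T₀ T₁ i` is the set of `h ∈ H` appearing with coefficient `i` in `T̂⁽⁴⁾T₁`. -/
def Vset {H : Type*} [CommGroup H] (T₀ T₁ : Set H) (i : ℕ) : Set H :=
  {h : H | {p : H × H | p.1 ∈ T₀ ∪ T₁ ∧ p.2 ∈ T₁ ∧ p.1 ^ 4 * p.2 = h}.ncard = i}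

/-- `θ₀ = |(T₀T₀ ∖ T₀⁽²⁾) ∩ T̂⁽⁴⁾|`. -/
noncomputable def theta0 {H : Type*} [CommGroup H] (T₀ T₁ : Set H) : ℕ :=
  (((T₀ * T₀) \ ((fun t => t ^ 2) '' T₀)) ∩ ((fun g => g ^ 4) '' (T₀ ∪ T₁))).ncard

/-- `θ₁ = |T₁ ∩ T̂⁽²⁾|/2 + |(T₁T₁ ∖ (T₁⁽²⁾ ∪ {e})) ∩ T̂⁽⁴⁾|`, as a rational number. -/
noncomputable def theta1 {H : Type*} [CommGroup H] (T₀ T₁ : Set H) : ℚ :=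
  ((T₁ ∩ ((fun g => g ^ 2) '' (T₀ ∪ T₁))).ncard : ℚ) / 2
    + ((((T₁ * T₁) \ (((fun t => t ^ 2) '' T₁) ∪ {1}))
        ∩ ((fun g => g ^ 4) '' (T₀ ∪ T₁))).ncard : ℚ)

/-- `s_i = (i−1)(i−4)/2` if `i ≡ 1 (mod 3)`, and `(i−2)(i−3)/2` otherwise. -/
def sCoef (i : ℕ) : ℚ :=
  if i % 3 = 1 then ((i : ℚ) - 1) * ((i : ℚ) - 4) / 2
  else ((i : ℚ) - 2) * ((i : ℚ) - 3) / 2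

open MonoidAlgebra Finset

/-- The sum of the elements of `s` in the integral group ring. -/
noncomputable def elementSum {H : Type*} [CommGroup H] (s : Finset H) : MonoidAlgebra ℤ H :=
  ∑ t ∈ s, single t 1

/-- The endomorphism `T ↦ T^{(k)}` of the integral group ring. -/
noncomputable def powHom (H : Type*) [CommGroup H] (k : ℕ) :
    MonoidAlgebra ℤ H →+* MonoidAlgebra ℤ H :=
  mapDomainRingHom ℤ (powMonoidHom k)

section GroupRing

variable {H : Type*} [CommGroup H]

lemma coeff_elementSum (s : Finset H) (h : H) :
    (elementSum s).coeff h = if h ∈ s then 1 else 0 := by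
  simp [elementSum, coeff_sum, Finsupp.single_apply]

lemma powHom_elementSum (k : ℕ) (s : Finset H) :
    powHom H k (elementSum s) = ∑ t ∈ s, single (t ^ k) 1 := by
  simp [powHom, elementSum, map_sum, mapDomainRingHom_apply, mapDomain_single]

lemma coeff_powHom_elementSum (k : ℕ) (s : Finset H) (h : H) :
    (powHom H k (elementSum s)).coeff h = #{t ∈ s | t ^ k = h} := by
  simp [powHom_elementSum, coeff_sum, Finsupp.single_apply]

lemma coeff_powHom_elementSum_nonneg (k : ℕ) (s : Finset H) (h : H) :
    0 ≤ (powHom H k (elementSum s)).coeff h := by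
  rw [coeff_powHom_elementSum]; positivity

lemma coeff_powHom_elementSum_eq_zero {k : ℕ} {s : Finset H} {h : H}
    (hh : h ∉ s.image (· ^ k)) : (powHom H k (elementSum s)).coeff h = 0 := by
  rw [coeff_powHom_elementSum]
  simp only [Finset.mem_image, not_exists, not_and] at hh
  simpa [Finset.filter_eq_empty_iff] using hh

lemma powHom_powHom (j k : ℕ) (f : MonoidAlgebra ℤ H) :
    powHom H j (powHom H k f) = powHom H (k * j) f := by
  rw [← RingHom.comp_apply, powHom, powHom, ← mapDomainRingHom_comp, powHom]
  congr 2
  ext g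
  simp [pow_mul]

lemma coeff_elementSum_mul_elementSum (s t : Finset H) (h : H) :
    (elementSum s * elementSum t).coeff h = #{p ∈ s ×ˢ t | p.1 * p.2 = h} := by
  simp [elementSum, Finset.sum_mul_sum, single_mul_single, coeff_sum, Finsupp.single_apply,
    ← Finset.sum_product']

lemma coeff_natCast_mul (k : ℕ) (f : MonoidAlgebra ℤ H) (h : H) :
    ((k : MonoidAlgebra ℤ H) * f).coeff h = k * f.coeff h := by
  rw [← nsmul_eq_mul, coeff_smul_apply, nsmul_eq_mul]

lemma coeff_intCast_mul (k : ℤ) (f : MonoidAlgebra ℤ H) (h : H) :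
    ((k : MonoidAlgebra ℤ H) * f).coeff h = k * f.coeff h := by
  rw [← zsmul_eq_mul, coeff_smul_apply, smul_eq_mul]

/-- Frobenius congruence in the integral group ring. -/
lemma exists_elementSum_pow_prime {p : ℕ} (hp : p.Prime) (s : Finset H) :
    ∃ C, elementSum s ^ p = powHom H p (elementSum s) + (p : MonoidAlgebra ℤ H) * C := by
  rw [powHom_elementSum, elementSum]
  induction s using Finset.induction_on with
  | empty => exact ⟨0, by simp [hp.ne_zero]⟩
  | insert a s ha ih =>
    obtain ⟨C, hC⟩ := ih
    obtain ⟨r, hr⟩ := exists_add_pow_prime_eq hp (single a 1) (∑ t ∈ s, single t (1 : ℤ))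
    refine ⟨C + single a 1 * (∑ t ∈ s, single t (1 : ℤ)) * r, ?_⟩
    rw [Finset.sum_insert ha, Finset.sum_insert ha, hr, hC, single_pow, one_pow]
    ring

/-- Elements of the group ring invariant under inversion of the group. -/
def IsInvSymm (f : MonoidAlgebra ℤ H) : Prop :=
  mapDomainRingHom ℤ (invMonoidHom (α := H)) f = f

lemma IsInvSymm.mul {f g : MonoidAlgebra ℤ H} (hf : IsInvSymm f) (hg : IsInvSymm g) :
    IsInvSymm (f * g) := by
  rw [IsInvSymm, map_mul, hf, hg]

lemma IsInvSymm.add {f g : MonoidAlgebra ℤ H} (hf : IsInvSymm f) (hg : IsInvSymm g) :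
    IsInvSymm (f + g) := by
  rw [IsInvSymm, map_add, hf, hg]

lemma IsInvSymm.powHom {f : MonoidAlgebra ℤ H} (hf : IsInvSymm f) (k : ℕ) :
    IsInvSymm (powHom H k f) := by
  have hcomm : (invMonoidHom (α := H)).comp (powMonoidHom k)
      = (powMonoidHom k).comp invMonoidHom := by
    ext g; simp
  rw [IsInvSymm, _root_.powHom, ← RingHom.comp_apply, ← mapDomainRingHom_comp, hcomm,
    mapDomainRingHom_comp, RingHom.comp_apply, hf]

lemma isInvSymm_elementSum {s : Finset H} (hs : ∀ t ∈ s, t⁻¹ ∈ s) :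
    IsInvSymm (elementSum s) := by
  simp only [IsInvSymm, elementSum, map_sum, mapDomainRingHom_apply, mapDomain_single]
  exact Finset.sum_nbij' (·⁻¹) (·⁻¹) hs hs (by simp) (by simp) (by simp)

lemma IsInvSymm.coeff_inv {f : MonoidAlgebra ℤ H} (hf : IsInvSymm f) (h : H) :
    f.coeff h⁻¹ = f.coeff h := by
  conv_lhs => rw [← hf]
  rw [mapDomainRingHom_apply, coeff_mapDomain]
  exact Finsupp.mapDomain_apply inv_injective _ _

lemma ncard_setOf_eq_card (s t : Finset H) (h : H) :
    {p : H × H | p.1 ∈ s ∧ p.2 ∈ t ∧ p.1 * p.2 = h}.ncard = #{p ∈ s ×ˢ t | p.1 * p.2 = h} := by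
  rw [← Set.ncard_coe_finset]
  congr 1
  ext p
  simp [and_assoc]

lemma ncard_setOf_sq_eq_card (s : Finset H) (h : H) :
    {t : H | t ∈ s ∧ t ^ 2 = h}.ncard = #{t ∈ s | t ^ 2 = h} := by
  rw [← Set.ncard_coe_finset]
  congr 1
  ext p
  simp

variable [Fintype H]

lemma coeff_mul_eq_sum (f g : MonoidAlgebra ℤ H) (h : H) :
    (f * g).coeff h = ∑ a, f.coeff a * g.coeff (a⁻¹ * h) := by
  rw [coeff_mul_apply_left, Finsupp.sum_fintype _ _ (by simp)]

lemma coeff_mul_nonneg {f g : MonoidAlgebra ℤ H} (hf : ∀ h, 0 ≤ f.coeff h)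
    (hg : ∀ h, 0 ≤ g.coeff h) (h : H) : 0 ≤ (f * g).coeff h := by
  rw [coeff_mul_eq_sum]
  exact Finset.sum_nonneg fun a _ => mul_nonneg (hf _) (hg _)

lemma IsInvSymm.sum_coeff_mul_coeff {g : MonoidAlgebra ℤ H} (hg : IsInvSymm g)
    (f : MonoidAlgebra ℤ H) : ∑ h, f.coeff h * g.coeff h = (f * g).coeff 1 := by
  simp [coeff_mul_eq_sum, hg.coeff_inv]

lemma sum_coeff_eq (f : MonoidAlgebra ℤ H) :
    ∑ h, f.coeff h = (f * elementSum univ).coeff 1 := by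
  simp [coeff_mul_eq_sum, coeff_elementSum]

lemma single_mul_elementSum_univ (a : H) :
    single a 1 * elementSum univ = elementSum (univ : Finset H) := by
  simp only [elementSum, Finset.mul_sum, single_mul_single, mul_one]
  exact Fintype.sum_equiv (Equiv.mulLeft a) _ _ fun _ => rfl

lemma elementSum_mul_univ (s : Finset H) :
    elementSum s * elementSum univ = (#s : MonoidAlgebra ℤ H) * elementSum univ := by
  conv_lhs => rw [elementSum, Finset.sum_mul]
  simp [single_mul_elementSum_univ]

lemma powHom_elementSum_mul_univ (k : ℕ) (s : Finset H) :
    powHom H k (elementSum s) * elementSum univ = (#s : MonoidAlgebra ℤ H) * elementSum univ := by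
  rw [powHom_elementSum, Finset.sum_mul]
  simp [single_mul_elementSum_univ]

lemma powHom_elementSum_univ {k : ℕ} (hk : (Nat.card H).Coprime k) :
    powHom H k (elementSum univ) = elementSum (univ : Finset H) := by
  rw [powHom_elementSum, elementSum]
  exact Fintype.sum_equiv (powCoprime hk) _ _ fun _ => rfl

lemma IsInvSymm.coeff_elementSum_sq {s : Finset H} (hs : IsInvSymm (elementSum s)) :
    (elementSum s * elementSum s).coeff 1 = #s := by
  rw [← hs.sum_coeff_mul_coeff]
  simp [coeff_elementSum]

end GroupRing

/-- Lower bound away from the exceptional set. -/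
lemma generic_bound {x y v : ℤ} (hx0 : 0 ≤ x) (hy0 : 0 ≤ y) (hv0 : 0 ≤ v)
    (hx : x % 3 = 1) (hy : y % 3 = 1) (hv : v % 5 = (4 - x - y) % 5) :
    1 + 11 * x + 11 * y - 5 * (x * y) - 3 * ((x - 1) * (x - 4)) - 3 * ((y - 1) * (y - 4))
      ≤ 9 * v := by
  obtain ⟨a, rfl⟩ : ∃ a, x = 3 * a + 1 := ⟨x / 3, by omega⟩
  obtain ⟨b, rfl⟩ : ∃ b, y = 3 * b + 1 := ⟨y / 3, by omega⟩
  have ha : 0 ≤ a := by omega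
  have hb : 0 ≤ b := by omega
  rcases (by omega : a = 0 ∨ a = 1 ∨ 2 ≤ a) with rfl | rfl | ha2
  · rcases (by omega : b = 0 ∨ b = 1 ∨ 2 ≤ b) with rfl | rfl | hb2
    · omega
    · omega
    · nlinarith
  · rcases (by omega : b = 0 ∨ b = 1 ∨ 2 ≤ b) with rfl | rfl | hb2
    · omega
    · omega
    · nlinarith
  · nlinarith [mul_nonneg ha hb, mul_nonneg (sub_nonneg.2 ha2) hb, mul_self_nonneg (b - 1),
      mul_nonneg (sub_nonneg.2 ha2) ha]

/-- Lower bound on the exceptional set. -/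
lemma exceptional_bound (x y : ℤ) :
    1 + 11 * x + 11 * y - 5 * (x * y) - 3 * ((x - 1) * (x - 4)) - 3 * ((y - 1) * (y - 4)) ≤ 39 := by
  nlinarith [sq_nonneg (6 * x + 5 * y - 26), sq_nonneg (11 * y - 26)]

section Main

variable {H : Type*} [CommGroup H] [Fintype H]

/-- Nonexistence in group-ring form, with the two sizes specified. -/
lemma false_of_elementSum_eqs {n : ℕ} (hge : 232 ≤ n) (h5 : n % 5 = 4) (h3 : n % 3 = 2)
    (hcard : Fintype.card H = n ^ 2 + n + 1) {s t : Finset H}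
    (hs : ∀ g ∈ s, g⁻¹ ∈ s) (ht : ∀ g ∈ t, g⁻¹ ∈ t) (hsn : #s = n) (htn : #t = n + 1)
    (h1 : elementSum s * elementSum t = elementSum univ - 1)
    (h2 : elementSum s ^ 2 + elementSum t ^ 2 + powHom H 2 (elementSum s)
      + powHom H 2 (elementSum t) = 2 * elementSum univ + 2 * (n : MonoidAlgebra ℤ H)) :
    False := by
  have hcop : (Nat.card H).Coprime 2 := by
    rw [Nat.card_eq_fintype_card, hcard, Nat.coprime_two_right]
    have := Nat.even_mul_succ_self n
    rw [show n ^ 2 + n + 1 = n * (n + 1) + 1 by ring]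
    exact this.add_one
  have hS2 := powHom_elementSum_univ hcop
  have hSS := elementSum_mul_univ (univ : Finset H)
  have hAS := elementSum_mul_univ s
  have hBS := elementSum_mul_univ t
  have hA2S := powHom_elementSum_mul_univ 2 s
  have hB2S := powHom_elementSum_mul_univ 2 t
  have hA4S := powHom_elementSum_mul_univ 4 s
  have hB4S := powHom_elementSum_mul_univ 4 t
  have k1 := congrArg (powHom H 2) h1
  have k2 := congrArg (powHom H 2) h2
  simp only [map_mul, map_sub, map_one, map_add, map_pow, map_ofNat, map_natCast, hS2,
    powHom_powHom, Nat.reduceMul] at k1 k2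
  rw [hsn] at hAS hA2S hA4S
  rw [htn] at hBS hB2S hB4S
  rw [card_univ, hcard] at hSS
  push_cast at hAS hBS hA2S hB2S hSS hA4S hB4S
  have symA := isInvSymm_elementSum hs
  have symB := isInvSymm_elementSum ht
  have sqA := symA.coeff_elementSum_sq
  have sqB := symB.coeff_elementSum_sq
  rw [hsn] at sqA
  rw [htn] at sqB
  have symT := (symA.powHom 2).add (symB.powHom 2)
  obtain ⟨C₃, hC₃⟩ := exists_elementSum_pow_prime Nat.prime_three s
  obtain ⟨D₃, hD₃⟩ := exists_elementSum_pow_prime Nat.prime_three t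
  obtain ⟨D₅, hD₅⟩ := exists_elementSum_pow_prime Nat.prime_five t
  have cA := coeff_elementSum s
  have cB := coeff_elementSum t
  have cS : ∀ h : H, (elementSum univ).coeff h = 1 := fun h => by simp [coeff_elementSum]
  have nA : ∀ h, 0 ≤ (elementSum s).coeff h := fun h => by rw [cA]; split_ifs <;> simp
  have nB : ∀ h, 0 ≤ (elementSum t).coeff h := fun h => by rw [cB]; split_ifs <;> simp
  have nT : ∀ k h, 0 ≤ (powHom H k (elementSum s) + powHom H k (elementSum t)).coeff h :=
    fun k h => add_nonneg (coeff_powHom_elementSum_nonneg ..) (coeff_powHom_elementSum_nonneg ..)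
  set A := elementSum s
  set B := elementSum t
  set S := elementSum (univ : Finset H)
  set T := powHom H 2 A + powHom H 2 B with hT
  set T₄ := powHom H 4 A + powHom H 4 B with hT₄
  have hTS : T * S = (2 * n + 1 : MonoidAlgebra ℤ H) * S := by
    linear_combination hA2S + hB2S
  have hT₄S : T₄ * S = (2 * n + 1 : MonoidAlgebra ℤ H) * S := by
    linear_combination hA4S + hB4S
  have hTT : T ^ 2 = 4 * S - T₄ + (2 * n - 2 : MonoidAlgebra ℤ H) := by
    linear_combination k2 + 2 * k1
  have hTe : T = 2 * S + 2 * (n : MonoidAlgebra ℤ H) - A ^ 2 - B ^ 2 := by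
    linear_combination h2
  have hTA : T * A = (n - 1 : MonoidAlgebra ℤ H) * S - A ^ 3 + B + 2 * n * A := by
    rw [hTe]; linear_combination 2 * hAS - B * h1 - hBS
  have hTB : T * B = (n + 2 : MonoidAlgebra ℤ H) * S - B ^ 3 + A + 2 * n * B := by
    rw [hTe]; linear_combination 2 * hBS - A * h1 - hAS
  have hT₄B : T₄ * B = (4 * (n + 1) - ((n + 2) * (2 * n + 1) - (n + 2) * (n + 1) ^ 2 - (n + 1)
      - 2 * n * (n + 2)) : MonoidAlgebra ℤ H) * S - B ^ 5 - T * A - 4 * n * (T * B) + 2 * n * A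
      + (4 * n ^ 2 + 2 * n - 3) * B := by
    have e₁ : T * (T * B) = ((n + 2) * (2 * n + 1) : MonoidAlgebra ℤ H) * S - B ^ 3 * T
        + T * A + 2 * n * (T * B) := by
      linear_combination T * hTB + (n + 2 : MonoidAlgebra ℤ H) * hTS
    have e₂ : B ^ 3 * T = ((n + 2) * (n + 1) ^ 2 : MonoidAlgebra ℤ H) * S - B ^ 5
        + ((n + 1) * S - B) + 2 * n * B ^ 3 := by
      linear_combination B ^ 2 * hTB + (n + 2 : MonoidAlgebra ℤ H) * (B + (n + 1)) * hBS
        + B * h1 + hBS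
    linear_combination B * hTT + 4 * hBS - e₁ + e₂ + (2 * n : MonoidAlgebra ℤ H) * hTB
  have mXX : ((T * A) * (T * A)).coeff 1 ≤ 6 * n ^ 2 - 2 * n := by
    have e : (T * A) * (T * A) = ((4 * n ^ 2 : ℤ) : MonoidAlgebra ℤ H) * S - T₄ * (A * A)
        + ((2 * n - 2 : ℤ) : MonoidAlgebra ℤ H) * (A * A) := by
      push_cast
      linear_combination A ^ 2 * hTT + 4 * (A + n) * hAS
    have := coeff_mul_nonneg (nT 4) (coeff_mul_nonneg nA nA) 1
    rw [e, coeff_add, coeff_sub, Finsupp.add_apply, Finsupp.sub_apply, coeff_intCast_mul,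
      coeff_intCast_mul, sqA, cS]
    linarith
  have mYY : ((T * B) * (T * B)).coeff 1 ≤ 6 * n ^ 2 + 8 * n + 2 := by
    have e : (T * B) * (T * B) = ((4 * (n + 1) ^ 2 : ℤ) : MonoidAlgebra ℤ H) * S - T₄ * (B * B)
        + ((2 * n - 2 : ℤ) : MonoidAlgebra ℤ H) * (B * B) := by
      push_cast
      linear_combination B ^ 2 * hTT + 4 * (B + (n + 1)) * hBS
    have := coeff_mul_nonneg (nT 4) (coeff_mul_nonneg nB nB) 1
    rw [e, coeff_add, coeff_sub, Finsupp.add_apply, Finsupp.sub_apply, coeff_intCast_mul,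
      coeff_intCast_mul, sqB, cS]
    push_cast
    linarith
  have mXY : ((T * A) * (T * B)).coeff 1 ≤ 4 * n ^ 2 + 4 * n := by
    have e : (T * A) * (T * B) = ((4 * (n ^ 2 + n) : ℤ) : MonoidAlgebra ℤ H) * S - T₄ * (A * B)
        + ((2 * n - 2 : ℤ) : MonoidAlgebra ℤ H) * (S - 1) := by
      push_cast
      linear_combination A * B * hTT + (2 * n - 2 + 4 * S : MonoidAlgebra ℤ H) * h1 + 4 * hSS
    have := coeff_mul_nonneg (nT 4) (coeff_mul_nonneg nA nB) 1
    rw [e, coeff_add, coeff_sub, Finsupp.add_apply, Finsupp.sub_apply, coeff_intCast_mul,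
      coeff_intCast_mul, coeff_sub, Finsupp.sub_apply, coeff_one_one, cS]
    linarith
  have mX : ((T * A) * S).coeff 1 = n * (2 * n + 1) := by
    have e : (T * A) * S = ((n * (2 * n + 1) : ℤ) : MonoidAlgebra ℤ H) * S := by
      push_cast
      linear_combination T * hAS + (n : MonoidAlgebra ℤ H) * hTS
    rw [e, coeff_intCast_mul, cS, mul_one]
  have mY : ((T * B) * S).coeff 1 = (n + 1) * (2 * n + 1) := by
    have e : (T * B) * S = (((n + 1) * (2 * n + 1) : ℤ) : MonoidAlgebra ℤ H) * S := by
      push_cast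
      linear_combination T * hBS + (n + 1 : MonoidAlgebra ℤ H) * hTS
    rw [e, coeff_intCast_mul, cS, mul_one]
  have mV : ((T₄ * B) * S).coeff 1 = (n + 1) * (2 * n + 1) := by
    have e : (T₄ * B) * S = (((n + 1) * (2 * n + 1) : ℤ) : MonoidAlgebra ℤ H) * S := by
      push_cast
      linear_combination T₄ * hBS + (n + 1 : MonoidAlgebra ℤ H) * hT₄S
    rw [e, coeff_intCast_mul, cS, mul_one]
  rw [← (symT.mul symA).sum_coeff_mul_coeff] at mXX
  rw [← (symT.mul symB).sum_coeff_mul_coeff] at mYY mXY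
  rw [← sum_coeff_eq] at mX mY mV
  have nX : ∀ h, 0 ≤ (T * A).coeff h := coeff_mul_nonneg (nT 2) nA
  have nY : ∀ h, 0 ≤ (T * B).coeff h := coeff_mul_nonneg (nT 2) nB
  have nV : ∀ h, 0 ≤ (T₄ * B).coeff h := coeff_mul_nonneg (nT 4) nB
  let D : Finset H := s ∪ t ∪ s.image (· ^ 3) ∪ t.image (· ^ 3) ∪ t.image (· ^ 5)
  have hD : (#D : ℤ) ≤ 5 * n + 3 := by
    have b₁ := card_union_le (s ∪ t ∪ s.image (· ^ 3) ∪ t.image (· ^ 3)) (t.image (· ^ 5))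
    have b₂ := card_union_le (s ∪ t ∪ s.image (· ^ 3)) (t.image (· ^ 3))
    have b₃ := card_union_le (s ∪ t) (s.image (· ^ 3))
    have b₄ := card_union_le s t
    have c₁ := card_image_le (s := s) (f := (· ^ 3))
    have c₂ := card_image_le (s := t) (f := (· ^ 3))
    have c₃ := card_image_le (s := t) (f := (· ^ 5))
    have : #D ≤ 5 * n + 3 := by
      simp only [D]
      omega
    exact_mod_cast this
  have key : ∀ h, 1 + 11 * (T * A).coeff h + 11 * (T * B).coeff h
      - 5 * ((T * A).coeff h * (T * B).coeff h)
      - 3 * (((T * A).coeff h - 1) * ((T * A).coeff h - 4))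
      - 3 * (((T * B).coeff h - 1) * ((T * B).coeff h - 4))
      ≤ 9 * (T₄ * B).coeff h + 39 * if h ∈ D then 1 else 0 := by
    intro h
    by_cases hh : h ∈ D
    · rw [if_pos hh]
      have := exceptional_bound ((T * A).coeff h) ((T * B).coeff h)
      have := nV h
      linarith
    · rw [if_neg hh, mul_zero, add_zero]
      simp only [D, Finset.mem_union, not_or] at hh
      obtain ⟨⟨⟨⟨hs', ht'⟩, hs3⟩, ht3⟩, ht5⟩ := hh
      have zA : A.coeff h = 0 := by rw [cA, if_neg hs']
      have zB : B.coeff h = 0 := by rw [cB, if_neg ht']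
      have zA3 : (powHom H 3 A).coeff h = 0 := coeff_powHom_elementSum_eq_zero hs3
      have zB3 : (powHom H 3 B).coeff h = 0 := coeff_powHom_elementSum_eq_zero ht3
      have zB5 : (powHom H 5 B).coeff h = 0 := coeff_powHom_elementSum_eq_zero ht5
      have eX : T * A = ((n - 1 : ℤ) : MonoidAlgebra ℤ H) * S - powHom H 3 A
          - ((3 : ℤ) : MonoidAlgebra ℤ H) * C₃ + B + ((2 * n : ℤ) : MonoidAlgebra ℤ H) * A := by
        push_cast at hC₃ ⊢
        linear_combination hTA - hC₃
      have eY : T * B = ((n + 2 : ℤ) : MonoidAlgebra ℤ H) * S - powHom H 3 B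
          - ((3 : ℤ) : MonoidAlgebra ℤ H) * D₃ + A + ((2 * n : ℤ) : MonoidAlgebra ℤ H) * B := by
        push_cast at hD₃ ⊢
        linear_combination hTB - hD₃
      have eV : T₄ * B = ((4 * (n + 1) - ((n + 2) * (2 * n + 1) - (n + 2) * (n + 1) ^ 2 - (n + 1)
          - 2 * n * (n + 2)) : ℤ) : MonoidAlgebra ℤ H) * S - powHom H 5 B
          - ((5 : ℤ) : MonoidAlgebra ℤ H) * D₅ - T * A
          - ((4 * n : ℤ) : MonoidAlgebra ℤ H) * (T * B) + ((2 * n : ℤ) : MonoidAlgebra ℤ H) * A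
          + ((4 * n ^ 2 + 2 * n - 3 : ℤ) : MonoidAlgebra ℤ H) * B := by
        push_cast at hD₅ ⊢
        linear_combination hT₄B - hD₅
      replace eX := congrArg (fun f => f.coeff h) eX
      replace eY := congrArg (fun f => f.coeff h) eY
      replace eV := congrArg (fun f => f.coeff h) eV
      simp only [coeff_add, coeff_sub, Finsupp.add_apply, Finsupp.sub_apply, coeff_intCast_mul,
        cS, zA, zB, zA3, zB3, zB5,
        mul_zero, mul_one, add_zero, sub_zero] at eX eY eV
      apply generic_bound (nX h) (nY h) (nV h)
      · omega
      · omega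
      · obtain ⟨k, hk⟩ : ∃ k : ℤ, (n : ℤ) = 5 * k + 4 := ⟨n / 5, by omega⟩
        rw [hk] at eV
        refine Int.modEq_iff_dvd.2 ⟨1 - (k + 1) * (5 * k + 5) * (5 * k + 6) - 4 * (k + 1)
          + D₅.coeff h + (4 * k + 3) * (T * B).coeff h, ?_⟩
        rw [eV]
        ring
  have total := Finset.sum_le_sum fun h (_ : h ∈ (univ : Finset H)) => key h
  have expand : ∀ h, 1 + 11 * (T * A).coeff h + 11 * (T * B).coeff h
      - 5 * ((T * A).coeff h * (T * B).coeff h)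
      - 3 * (((T * A).coeff h - 1) * ((T * A).coeff h - 4))
      - 3 * (((T * B).coeff h - 1) * ((T * B).coeff h - 4))
      = -23 + 26 * (T * A).coeff h + 26 * (T * B).coeff h
      - 5 * ((T * A).coeff h * (T * B).coeff h)
      - 3 * ((T * A).coeff h * (T * A).coeff h)
      - 3 * ((T * B).coeff h * (T * B).coeff h) := fun h => by ring
  simp only [expand, Finset.sum_sub_distrib, Finset.sum_add_distrib, ← Finset.mul_sum, mX, mY, mV,
    Finset.sum_const, card_univ, hcard, Finset.sum_boole, Finset.filter_univ_mem, nsmul_eq_mul]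
    at total
  push_cast at total
  have hge' : (232 : ℤ) ≤ n := by exact_mod_cast hge
  nlinarith

lemma elementSum_eqs_of_APLLEqs {n : ℕ} {s t : Finset H}
    (h : APLLEqs n (s : Set H) (t : Set H)) :
    elementSum s * elementSum t = elementSum univ - 1 ∧
      elementSum s ^ 2 + elementSum t ^ 2 + powHom H 2 (elementSum s)
        + powHom H 2 (elementSum t) = 2 * elementSum univ + 2 * (n : MonoidAlgebra ℤ H) := by
  obtain ⟨h₁, h₂⟩ := h
  simp only [SetLike.mem_coe, ncard_setOf_eq_card, ncard_setOf_sq_eq_card] at h₁ h₂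
  have one_coeff (g : H) : (1 : MonoidAlgebra ℤ H).coeff g = if g = 1 then 1 else 0 := by
    simp [one_def, Finsupp.single_apply, eq_comm]
  constructor
  · ext g
    rw [coeff_elementSum_mul_elementSum, h₁, coeff_sub, Finsupp.sub_apply, coeff_elementSum,
      one_coeff]
    split_ifs <;> simp_all
  · ext g
    have h := congrArg (Nat.cast (R := ℤ)) (h₂ g)
    have e : 2 * elementSum univ + 2 * (n : MonoidAlgebra ℤ H)
        = ((2 : ℕ) : MonoidAlgebra ℤ H) * elementSum univ
          + ((2 * n : ℕ) : MonoidAlgebra ℤ H) * 1 := by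
      push_cast; ring
    rw [e]
    simp only [sq (elementSum _), coeff_add, Finsupp.add_apply, coeff_elementSum_mul_elementSum,
      coeff_powHom_elementSum, coeff_natCast_mul, one_coeff, coeff_elementSum, mem_univ, if_true]
    push_cast at h ⊢
    rw [h]
    split_ifs <;> simp

lemma card_of_elementSum_eqs {n : ℕ} (hcard : Fintype.card H = n ^ 2 + n + 1) {s t : Finset H}
    (h1 : elementSum s * elementSum t = elementSum univ - 1)
    (h2 : elementSum s ^ 2 + elementSum t ^ 2 + powHom H 2 (elementSum s)
      + powHom H 2 (elementSum t) = 2 * elementSum univ + 2 * (n : MonoidAlgebra ℤ H)) :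
    (#s = n ∧ #t = n + 1) ∨ (#t = n ∧ #s = n + 1) := by
  have hSS := elementSum_mul_univ (univ : Finset H)
  rw [card_univ, hcard] at hSS
  push_cast at hSS
  have hA := elementSum_mul_univ s
  have hB := elementSum_mul_univ t
  have e₁ : ((#s * #t : ℤ) : MonoidAlgebra ℤ H) * elementSum univ
      = ((n ^ 2 + n : ℤ) : MonoidAlgebra ℤ H) * elementSum univ := by
    push_cast
    linear_combination elementSum univ * h1 - elementSum s * hB - (#t : MonoidAlgebra ℤ H) * hA
      + hSS
  have e₂ : ((#s ^ 2 + #t ^ 2 + #s + #t : ℤ) : MonoidAlgebra ℤ H) * elementSum univ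
      = ((2 * (n ^ 2 + n + 1) + 2 * n : ℤ) : MonoidAlgebra ℤ H) * elementSum univ := by
    push_cast
    linear_combination elementSum univ * h2 - (elementSum s + #s) * hA - (elementSum t + #t) * hB
      - powHom_elementSum_mul_univ 2 s - powHom_elementSum_mul_univ 2 t + 2 * hSS
  replace e₁ := congrArg (fun f => f.coeff (1 : H)) e₁
  replace e₂ := congrArg (fun f => f.coeff (1 : H)) e₂
  simp only [coeff_intCast_mul, coeff_elementSum, mem_univ, if_true, mul_one] at e₁ e₂
  have hsum : (#s : ℤ) + #t = 2 * n + 1 := by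
    have : ((#s : ℤ) + #t - (2 * n + 1)) * (#s + #t + 2 * n + 2) = 0 := by
      linear_combination e₂ + 2 * e₁
    rcases mul_eq_zero.1 this with h | h <;> omega
  have hprod : ((#s : ℤ) - n) * (#s - (n + 1)) = 0 := by
    linear_combination (#s : ℤ) * hsum - e₁
  rcases mul_eq_zero.1 hprod with h | h <;> omega

end Main

/-- Nonexistence of inverse-closed subsets `T₀, T₁` with `e ∈ T₀` satisfying the
APLL group-ring equations, in any finite abelian group of order `n²+n+1`. -/
theorem no_APLL_subsets_odd_ge232_4mod5_2mod3 (n : ℕ) (hn : 0 < n)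
    (hodd : Odd n) (hge : 232 ≤ n) (h5 : n % 5 = 4) (h3 : n % 3 = 2)
    (H : Type*) [CommGroup H] [Fintype H]
    (hcard : Fintype.card H = n ^ 2 + n + 1) :
    ¬ ∃ T₀ T₁ : Set H,
        T₀⁻¹ = T₀ ∧ T₁⁻¹ = T₁ ∧ (1 : H) ∈ T₀ ∧ APLLEqs n T₀ T₁ := by
  rintro ⟨T₀, T₁, hT₀, hT₁, -, hT⟩
  lift T₀ to Finset H using T₀.toFinite
  lift T₁ to Finset H using T₁.toFinite
  have inv₀ : ∀ g ∈ T₀, g⁻¹ ∈ T₀ := fun g hg => by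
    rwa [← SetLike.mem_coe, ← hT₀, Set.inv_mem_inv]
  have inv₁ : ∀ g ∈ T₁, g⁻¹ ∈ T₁ := fun g hg => by
    rwa [← SetLike.mem_coe, ← hT₁, Set.inv_mem_inv]
  obtain ⟨h1, h2⟩ := elementSum_eqs_of_APLLEqs hT
  rcases card_of_elementSum_eqs hcard h1 h2 with ⟨hs, ht⟩ | ⟨ht, hs⟩
  · exact false_of_elementSum_eqs hge h5 h3 hcard inv₀ inv₁ hs ht h1 h2
  · exact false_of_elementSum_eqs hge h5 h3 hcard inv₁ inv₀ ht hs
      (by rw [mul_comm, h1]) (by rw [← h2]; ring)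
end

section
/- Let n be a positive odd integer with n ≥ 207, n ≡ 1 (mod 5) and n ≡ 2 (mod 3). Then for every finite abelian group H of order n²+n+1 there exist no inverse-closed subsets T₀, T₁ of H with e ∈ T₀ satisfying the APLL group-ring equations. -/
open scoped Classical Pointwise

namespace APLL

open Finset

section GroupRing

variable {H : Type*} [CommGroup H]

/-- The element `A^{(k)} = ∑_{g ∈ A} g ^ k` of the integral group ring. -/
noncomputable def powSum (k : ℕ) (A : Finset H) : MonoidAlgebra ℤ H :=
  ∑ g ∈ A, MonoidAlgebra.single (g ^ k) 1

lemma coeff_intCast_mul (c : ℤ) (x : MonoidAlgebra ℤ H) (h : H) :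
    ((c : MonoidAlgebra ℤ H) * x).coeff h = c * x.coeff h := by
  rw [← zsmul_eq_mul, MonoidAlgebra.coeff_smul_apply, smul_eq_mul]

lemma coeff_intCast (c : ℤ) (h : H) :
    (c : MonoidAlgebra ℤ H).coeff h = if h = 1 then c else 0 := by
  rw [← mul_one (c : MonoidAlgebra ℤ H), coeff_intCast_mul, MonoidAlgebra.one_def,
    MonoidAlgebra.coeff_single, Finsupp.single_apply]
  simp [eq_comm]

lemma coeff_powSum (k : ℕ) (A : Finset H) (h : H) :
    (powSum k A).coeff h = #{g ∈ A | g ^ k = h} := by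
  simp [powSum, MonoidAlgebra.coeff_sum, Finsupp.finsetSum_apply, Finsupp.single_apply]

lemma coeff_powSum_mul (i j : ℕ) (A B : Finset H) (h : H) :
    (powSum i A * powSum j B).coeff h = #{p ∈ A ×ˢ B | p.1 ^ i * p.2 ^ j = h} := by
  rw [powSum, powSum, Finset.sum_mul_sum, ← Finset.sum_product']
  simp [MonoidAlgebra.coeff_sum, Finsupp.finsetSum_apply, Finsupp.single_apply]

lemma coeff_powSum_eq_zero {k : ℕ} {A : Finset H} {h : H} (hh : h ∉ A.image (· ^ k)) :
    (powSum k A).coeff h = 0 := by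
  rw [coeff_powSum, Finset.filter_eq_empty_iff.2]
  · simp
  · intro g hg e
    exact hh (Finset.mem_image.2 ⟨g, hg, e⟩)

lemma coeff_powSum_le_one {k : ℕ} (hk : Function.Injective (fun g : H => g ^ k))
    (A : Finset H) (h : H) : (powSum k A).coeff h ≤ 1 := by
  rw [coeff_powSum]
  norm_cast
  refine Finset.card_le_one.2 fun a ha b hb => hk ?_
  simp only [Finset.mem_filter] at ha hb
  exact ha.2.trans hb.2.symm

lemma coeff_powSum_nonneg (k : ℕ) (A : Finset H) (h : H) : 0 ≤ (powSum k A).coeff h := by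
  rw [coeff_powSum]
  positivity

lemma mapDomain_powSum (k j : ℕ) (A : Finset H) :
    MonoidAlgebra.mapDomainRingHom ℤ (powMonoidHom k) (powSum j A) = powSum (j * k) A := by
  simp [powSum, map_sum, pow_mul]

lemma exists_powSum_one_pow {p : ℕ} (hp : p.Prime) (A : Finset H) :
    ∃ r, powSum 1 A ^ p = powSum p A + p * r := by
  induction A using Finset.induction_on with
  | empty => exact ⟨0, by simp [powSum, hp.ne_zero]⟩
  | insert a s ha ih =>
    obtain ⟨r, hr⟩ := ih
    have hins (k : ℕ) : powSum k (insert a s) = MonoidAlgebra.single (a ^ k) 1 + powSum k s := by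
      simp [powSum, ha]
    obtain ⟨t, ht⟩ := exists_add_pow_prime_eq hp (MonoidAlgebra.single (a ^ 1) (1 : ℤ))
      (powSum 1 s)
    rw [hins, hins, ht, hr, MonoidAlgebra.single_pow]
    refine ⟨r + MonoidAlgebra.single (a ^ 1) 1 * powSum 1 s * t, ?_⟩
    simp only [pow_one, one_pow]
    ring

lemma coeff_inv {x : MonoidAlgebra ℤ H}
    (hx : MonoidAlgebra.mapDomainRingHom ℤ (invMonoidHom : H →* H) x = x) (h : H) :
    x.coeff h⁻¹ = x.coeff h := by
  nth_rw 1 [← hx]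
  exact Finsupp.mapDomain_apply inv_injective x.coeff h

lemma mapDomain_inv_powSum {A : Finset H} (hA : ∀ g ∈ A, g⁻¹ ∈ A) (k : ℕ) :
    MonoidAlgebra.mapDomainRingHom ℤ (invMonoidHom : H →* H) (powSum k A) = powSum k A := by
  simp only [powSum, map_sum, MonoidAlgebra.mapDomainRingHom_apply,
    MonoidAlgebra.mapDomain_single, invMonoidHom_apply]
  exact Finset.sum_bij' (fun g _ => g⁻¹) (fun g _ => g⁻¹) hA hA (by simp) (by simp) (by simp)

variable [Fintype H]

lemma coeff_mul_one (x y : MonoidAlgebra ℤ H) :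
    (x * y).coeff 1 = ∑ h, x.coeff h * y.coeff h⁻¹ := by
  rw [MonoidAlgebra.coeff_mul_apply_left, Finsupp.sum_fintype] <;> simp

lemma coeff_powSum_one_univ (h : H) : (powSum 1 (univ : Finset H)).coeff h = 1 := by
  rw [coeff_powSum, Finset.card_eq_one.2 ⟨h, by ext; simp⟩, Nat.cast_one]

lemma powSum_mul_univ (k : ℕ) (A : Finset H) :
    powSum k A * powSum 1 univ = ((#A : ℤ) : MonoidAlgebra ℤ H) * powSum 1 univ := by
  have key (g : H) :
      MonoidAlgebra.single g (1 : ℤ) * powSum 1 univ = powSum 1 univ := by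
    simp only [powSum, Finset.mul_sum, pow_one, MonoidAlgebra.single_mul_single, mul_one]
    exact Fintype.sum_equiv (Equiv.mulLeft g) _ _ fun _ => rfl
  rw [powSum, Finset.sum_mul, Finset.sum_congr rfl fun g _ => key (g ^ k)]
  simp

lemma sum_coeff (x : MonoidAlgebra ℤ H) :
    ∑ h, x.coeff h = (x * powSum 1 univ).coeff 1 := by
  simp [coeff_mul_one, coeff_powSum_one_univ]

lemma sum_coeff_powSum (k : ℕ) (A : Finset H) : ∑ h, (powSum k A).coeff h = #A := by
  rw [sum_coeff, powSum_mul_univ, coeff_intCast_mul, coeff_powSum_one_univ, mul_one]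

end GroupRing

/-- The equations satisfied in the group ring by `a = T₀`, `b = T₁`, `c₂ = (T₀ + T₁)^{(2)}`,
`c₄ = (T₀ + T₁)^{(4)}` and the sum `J` of all group elements, when `|T₁| = n + 1`. -/
structure Relations {R : Type*} [CommRing R] (n a b c₂ c₄ J : R) : Prop where
  mul_eq : a * b = J - 1
  sq_add_sq : a ^ 2 + b ^ 2 = 2 * J - c₂ + 2 * n
  sq_c₂ : c₂ ^ 2 = 4 * J - c₄ + 2 * n - 2
  left_mul : a * J = n * J
  right_mul : b * J = (n + 1) * J
  c₂_mul : c₂ * J = (2 * n + 1) * J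
  c₄_mul : c₄ * J = (2 * n + 1) * J

namespace Relations

variable {R : Type*} [CommRing R] {n a b c₂ c₄ J : R}

lemma right_pow_five (h : Relations n a b c₂ c₄ J) :
    b ^ 5 = ((n + 2) * (n + 1) ^ 2 + (n + 1) + 2 * n * (n + 2) - (n + 2) * (2 * n + 1)
        + 4 * (n + 1)) * J + 2 * n * a + (4 * n ^ 2 + 2 * n - 3) * b
      - 4 * n * (c₂ * b) - c₂ * a - c₄ * b := by
  obtain ⟨h1, h2, h3, h4, h5, h6, -⟩ := h
  have hb3 : b ^ 3 = (n + 2) * J + a + 2 * n * b - c₂ * b := by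
    linear_combination b * h2 - a * h1 + 2 * h5 - h4
  linear_combination (b ^ 2 + 2 * n - c₂) * hb3 + b * h1 + b * h3
    + ((n + 2) * (b + n + 1) + 5) * h5 - (n + 2) * h6

lemma sq_diff (h : Relations n a b c₂ c₄ J) : (b - a) ^ 2 = 2 * n + 2 - c₂ := by
  linear_combination h.sq_add_sq - 2 * h.mul_eq

lemma c₂_mul_diff (h : Relations n a b c₂ c₄ J) :
    c₂ * (b - a) = (2 * n + 2) * (b - a) - (b - a) ^ 3 := by
  linear_combination (b - a) * h.sq_diff

lemma sq_c₂_mul_diff (h : Relations n a b c₂ c₄ J) :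
    (c₂ * (b - a)) ^ 2 = 4 * J + (4 * n ^ 2 - 4) - (2 * n - 2) * c₂ - (2 * n + 2) * c₄
      + c₄ * c₂ := by
  linear_combination c₂ ^ 2 * h.sq_diff + (2 * n + 2 - c₂) * h.sq_c₂ - 4 * h.c₂_mul

end Relations

section Group

variable {H : Type*} [CommGroup H] [Fintype H]

/-- The two equations in the group ring satisfied by finite subsets `A = T₀` and `B = T₁`. -/
structure IsPair (n : ℕ) (A B : Finset H) : Prop where
  mul_eq : powSum 1 A * powSum 1 B = powSum 1 univ - 1
  sq_add_sq : powSum 1 A ^ 2 + powSum 1 B ^ 2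
    = 2 * powSum 1 univ - (powSum 2 A + powSum 2 B) + 2 * ((n : ℤ) : MonoidAlgebra ℤ H)

namespace IsPair

variable {n : ℕ} {A B : Finset H}

lemma symm (h : IsPair n A B) : IsPair n B A :=
  ⟨by rw [mul_comm, h.mul_eq], by rw [add_comm, h.sq_add_sq, add_comm (powSum 2 A)]⟩

lemma card_eq (h : IsPair n A B) (hcard : Fintype.card H = n ^ 2 + n + 1) :
    #A = n ∧ #B = n + 1 ∨ #B = n ∧ #A = n + 1 := by
  have hJ (c : ℤ) (hc : (c : MonoidAlgebra ℤ H) * powSum 1 univ = 0) : c = 0 := by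
    have := coeff_intCast_mul c (powSum 1 (univ : Finset H)) 1
    rw [hc, coeff_powSum_one_univ] at this
    simpa using this.symm
  have hA := powSum_mul_univ 1 A
  have hB := powSum_mul_univ 1 B
  have hA2 := powSum_mul_univ 2 A
  have hB2 := powSum_mul_univ 2 B
  have hU := powSum_mul_univ 1 (univ : Finset H)
  rw [Finset.card_univ, hcard] at hU
  have h1 : (#A : ℤ) * #B - (n ^ 2 + n) = 0 := hJ _ <| by
    push_cast at *
    linear_combination powSum 1 univ * h.mul_eq - powSum 1 B * hA - #A * hB + hU
  have h2 : (#A : ℤ) ^ 2 + #B ^ 2 + #A + #B - 2 * (n ^ 2 + n + 1) - 2 * n = 0 := hJ _ <| by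
    push_cast at *
    linear_combination powSum 1 univ * h.sq_add_sq - (powSum 1 A + #A) * hA
      - (powSum 1 B + #B) * hB - hA2 - hB2 + 2 * hU
  have h3 : ((#A : ℤ) + #B - (2 * n + 1)) * (#A + #B + 2 * n + 2) = 0 := by
    linear_combination h2 + 2 * h1
  have h4 : (#A : ℤ) + #B - (2 * n + 1) = 0 :=
    (mul_eq_zero.1 h3).resolve_right (by positivity)
  have h5 : ((#A : ℤ) - n) * (#A - (n + 1)) = 0 := by
    linear_combination #A * h4 - h1
  rcases mul_eq_zero.1 h5 with h5 | h5 <;> omega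

lemma relations (h : IsPair n A B) (hA : #A = n) (hB : #B = n + 1)
    (hinj : Function.Injective (fun g : H => g ^ 2)) :
    Relations ((n : ℤ) : MonoidAlgebra ℤ H) (powSum 1 A) (powSum 1 B)
      (powSum 2 A + powSum 2 B) (powSum 4 A + powSum 4 B) (powSum 1 univ) where
  mul_eq := h.mul_eq
  sq_add_sq := h.sq_add_sq
  sq_c₂ := by
    have huniv : powSum 2 (univ : Finset H) = powSum 1 univ := by
      simp only [powSum, pow_one]
      exact Fintype.sum_bijective _ (Finite.injective_iff_bijective.1 hinj) _ _ fun _ => rfl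
    have hsq : (powSum 1 A + powSum 1 B) ^ 2
        = 4 * powSum 1 univ - (powSum 2 A + powSum 2 B) + 2 * ((n : ℤ) : MonoidAlgebra ℤ H) - 2 := by
      linear_combination h.sq_add_sq + 2 * h.mul_eq
    have := congrArg (MonoidAlgebra.mapDomainRingHom ℤ (powMonoidHom 2 : H →* H)) hsq
    simpa only [map_pow, map_add, map_sub, map_mul, map_ofNat, map_intCast, mapDomain_powSum,
      one_mul, Nat.reduceMul, huniv] using this
  left_mul := by rw [powSum_mul_univ, hA]
  right_mul := by rw [powSum_mul_univ, hB]; push_cast; ring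
  c₂_mul := by rw [add_mul, powSum_mul_univ, powSum_mul_univ, hA, hB]; push_cast; ring
  c₄_mul := by rw [add_mul, powSum_mul_univ, powSum_mul_univ, hA, hB]; push_cast; ring

end IsPair

/-- A pointwise bound at an element where the congruences modulo 3 and 5 hold exactly. -/
lemma bound_of_congr {z v : ℤ} (hz : z % 3 = 0) (hv : (v - 4 - z) % 5 = 0) (hv0 : 0 ≤ v) :
    72 + 3 * z - 5 * z ^ 2 ≤ 18 * v := by
  obtain ⟨d, rfl⟩ := Int.dvd_of_emod_eq_zero hz
  by_cases hd : d ≤ -2 ∨ 2 ≤ d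
  · rcases hd with hd | hd <;> nlinarith
  · obtain rfl | rfl | rfl : d = -1 ∨ d = 0 ∨ d = 1 := by omega
    all_goals omega

namespace IsPair

variable {n : ℕ} {A B : Finset H}

lemma sum_sq_coeff_le (h : IsPair n A B) (hn : 0 < n) (hA : #A = n) (hB : #B = n + 1)
    (hinj : Function.Injective (fun g : H => g ^ 2))
    (hAinv : ∀ g ∈ A, g⁻¹ ∈ A) (hBinv : ∀ g ∈ B, g⁻¹ ∈ B) :
    ∑ g, ((powSum 2 A + powSum 2 B) * (powSum 1 B - powSum 1 A)).coeff g ^ 2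
      ≤ 4 * n ^ 2 + 2 * n + 1 := by
  have hrel := h.relations hA hB hinj
  have hdisj : Disjoint A B := by
    refine Finset.disjoint_left.2 fun g hgA hgB => ?_
    have := congrArg (fun x => x.coeff 1) hrel.mul_eq
    simp only [MonoidAlgebra.coeff_sub, Finsupp.sub_apply, coeff_powSum_one_univ,
      MonoidAlgebra.coeff_one_one, coeff_powSum_mul, sub_self, Nat.cast_eq_zero,
      Finset.card_eq_zero, Finset.filter_eq_empty_iff, Finset.mem_product] at this
    exact this (x := (g, g⁻¹)) ⟨hgA, hBinv g hgB⟩ (by simp)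
  have hunion (k : ℕ) : powSum k A + powSum k B = powSum k (A ∪ B) :=
    (Finset.sum_union hdisj).symm
  have hsum : ∑ g, (powSum 4 A + powSum 4 B).coeff g = 2 * n + 1 := by
    rw [hunion, sum_coeff_powSum, Finset.card_union_of_disjoint hdisj, hA, hB]
    push_cast
    ring
  have hinvol : MonoidAlgebra.mapDomainRingHom ℤ (invMonoidHom : H →* H)
      ((powSum 2 A + powSum 2 B) * (powSum 1 B - powSum 1 A))
        = (powSum 2 A + powSum 2 B) * (powSum 1 B - powSum 1 A) := by
    simp only [map_mul, map_add, map_sub, mapDomain_inv_powSum hAinv, mapDomain_inv_powSum hBinv]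
  have hsq : ∑ g, ((powSum 2 A + powSum 2 B) * (powSum 1 B - powSum 1 A)).coeff g ^ 2
      = (((powSum 2 A + powSum 2 B) * (powSum 1 B - powSum 1 A)) ^ 2).coeff 1 := by
    rw [sq, coeff_mul_one]
    simp only [coeff_inv hinvol, sq]
  have hcross : ((powSum 4 A + powSum 4 B) * (powSum 2 A + powSum 2 B)).coeff 1 ≤ 2 * n + 1 := by
    rw [coeff_mul_one, ← hsum]
    refine Finset.sum_le_sum fun g _ => mul_le_of_le_one_right ?_ ?_
    · rw [hunion]
      exact coeff_powSum_nonneg _ _ _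
    · rw [hunion]
      exact coeff_powSum_le_one hinj _ _
  have key : ((powSum 2 A + powSum 2 B) * (powSum 1 B - powSum 1 A)) ^ 2
      = ((4 : ℤ) : MonoidAlgebra ℤ H) * powSum 1 univ
        + ((4 * n ^ 2 - 4 : ℤ) : MonoidAlgebra ℤ H)
        - ((2 * n - 2 : ℤ) : MonoidAlgebra ℤ H) * (powSum 2 A + powSum 2 B)
        - ((2 * n + 2 : ℤ) : MonoidAlgebra ℤ H) * (powSum 4 A + powSum 4 B)
        + (powSum 4 A + powSum 4 B) * (powSum 2 A + powSum 2 B) := by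
    rw [hrel.sq_c₂_mul_diff]
    push_cast
    ring
  rw [hsq, key]
  have h₂ := coeff_powSum_nonneg 2 (A ∪ B) 1
  have h₄ := coeff_powSum_nonneg 4 (A ∪ B) 1
  rw [← hunion] at h₂ h₄
  rw [MonoidAlgebra.coeff_add, Finsupp.add_apply, MonoidAlgebra.coeff_sub, Finsupp.sub_apply,
    MonoidAlgebra.coeff_sub, Finsupp.sub_apply, MonoidAlgebra.coeff_add, Finsupp.add_apply,
    coeff_intCast_mul, coeff_intCast_mul, coeff_intCast_mul, coeff_intCast, if_pos rfl,
    coeff_powSum_one_univ]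
  have hn' : (1 : ℤ) ≤ n := by exact_mod_cast hn
  have := mul_nonneg (by linarith : (0 : ℤ) ≤ 2 * n - 2) h₂
  have := mul_nonneg (by linarith : (0 : ℤ) ≤ 2 * n + 2) h₄
  linarith

lemma bound (h : IsPair n A B) (hn : n % 5 = 1) (hA : #A = n) (hB : #B = n + 1)
    (hinj : Function.Injective (fun g : H => g ^ 2)) {g : H}
    (hg₁ : g ∉ (A ∪ B).image (· ^ 1)) (hg₃ : g ∉ (A ∪ B).image (· ^ 3))
    (hg₅ : g ∉ B.image (· ^ 5)) :
    72 + 3 * ((powSum 2 A + powSum 2 B) * (powSum 1 B - powSum 1 A)).coeff g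
        - 5 * ((powSum 2 A + powSum 2 B) * (powSum 1 B - powSum 1 A)).coeff g ^ 2
      ≤ 18 * ((powSum 4 A + powSum 4 B) * powSum 1 B).coeff g := by
  have hrel := h.relations hA hB hinj
  simp only [Finset.image_union, Finset.mem_union, not_or] at hg₁ hg₃
  have hA₁ := coeff_powSum_eq_zero hg₁.1
  have hB₁ := coeff_powSum_eq_zero hg₁.2
  have hA₃ := coeff_powSum_eq_zero hg₃.1
  have hB₃ := coeff_powSum_eq_zero hg₃.2
  have hB₅ := coeff_powSum_eq_zero hg₅
  apply bound_of_congr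
  · obtain ⟨r, hr⟩ := exists_powSum_one_pow Nat.prime_three A
    obtain ⟨s, hs⟩ := exists_powSum_one_pow Nat.prime_three B
    have key : (powSum 2 A + powSum 2 B) * (powSum 1 B - powSum 1 A)
        = ((2 * n + 2 : ℤ) : MonoidAlgebra ℤ H) * (powSum 1 B - powSum 1 A) - powSum 3 B
          + powSum 3 A
          + ((3 : ℤ) : MonoidAlgebra ℤ H)
            * (r - s + powSum 1 B ^ 2 * powSum 1 A - powSum 1 B * powSum 1 A ^ 2) := by
      rw [hrel.c₂_mul_diff]
      push_cast at *
      linear_combination hr - hs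
    rw [key]
    simp only [MonoidAlgebra.coeff_add, MonoidAlgebra.coeff_sub, Finsupp.add_apply,
      Finsupp.sub_apply, coeff_intCast_mul, hA₁, hB₁, hA₃, hB₃]
    omega
  · obtain ⟨r, hr⟩ := exists_powSum_one_pow Nat.prime_five B
    obtain ⟨k, rfl⟩ : ∃ k : ℕ, n = 5 * k + 1 := ⟨n / 5, by omega⟩
    have key : (powSum 4 A + powSum 4 B) * powSum 1 B
          - (powSum 2 A + powSum 2 B) * (powSum 1 B - powSum 1 A)
        = ((4 : ℤ) : MonoidAlgebra ℤ H) * powSum 1 univ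
          + ((2 * (5 * k + 1) : ℤ) : MonoidAlgebra ℤ H) * powSum 1 A
          + ((4 * (5 * k + 1) ^ 2 + 2 * (5 * k + 1) - 3 : ℤ) : MonoidAlgebra ℤ H) * powSum 1 B
          - powSum 5 B
          + ((5 : ℤ) : MonoidAlgebra ℤ H)
            * (((25 * k ^ 3 + 35 * k ^ 2 + 20 * k + 3 : ℤ) : MonoidAlgebra ℤ H) * powSum 1 univ
              - ((4 * k + 1 : ℤ) : MonoidAlgebra ℤ H)
                * ((powSum 2 A + powSum 2 B) * powSum 1 B) - r) := by
      have := hrel.right_pow_five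
      push_cast at *
      linear_combination this - hr
    have := congrArg (fun x => x.coeff g) key
    simp only [MonoidAlgebra.coeff_add, MonoidAlgebra.coeff_sub, Finsupp.add_apply,
      Finsupp.sub_apply, coeff_intCast_mul, hA₁, hB₁, hB₅, coeff_powSum_one_univ] at this
    omega
  · simp only [add_mul, MonoidAlgebra.coeff_add, Finsupp.add_apply, coeff_powSum_mul]
    positivity

lemma mod_five_ne_one (h : IsPair n A B) (hcard : Fintype.card H = n ^ 2 + n + 1) (hn : 23 ≤ n)
    (hA : #A = n) (hB : #B = n + 1) (hinj : Function.Injective (fun g : H => g ^ 2))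
    (hAinv : ∀ g ∈ A, g⁻¹ ∈ A) (hBinv : ∀ g ∈ B, g⁻¹ ∈ B) : n % 5 ≠ 1 := by
  intro h5
  have hrel := h.relations hA hB hinj
  set z := (powSum 2 A + powSum 2 B) * (powSum 1 B - powSum 1 A) with hz
  set v := (powSum 4 A + powSum 4 B) * powSum 1 B with hv
  set bad := (A ∪ B).image (· ^ 1) ∪ (A ∪ B).image (· ^ 3) ∪ B.image (· ^ 5) with hbad
  have hpoint (g : H) : 72 + 3 * z.coeff g - 5 * z.coeff g ^ 2
      ≤ 18 * v.coeff g + 72 * if g ∈ bad then 1 else 0 := by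
    split_ifs with hg
    · have hv0 : 0 ≤ v.coeff g := by
        simp only [hv, add_mul, MonoidAlgebra.coeff_add, Finsupp.add_apply, coeff_powSum_mul]
        positivity
      nlinarith [Int.le_self_sq (z.coeff g), sq_nonneg (z.coeff g)]
    · simp only [hbad, Finset.mem_union, not_or] at hg
      have := h.bound h5 hA hB hinj (g := g) hg.1.1 hg.1.2 hg.2
      linarith
  have hbad_card : (#bad : ℤ) ≤ 5 * n + 3 := by
    have h₁ := Finset.card_image_le (s := A ∪ B) (f := fun g => g ^ 1)
    have h₃ := Finset.card_image_le (s := A ∪ B) (f := fun g => g ^ 3)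
    have h₅ := Finset.card_image_le (s := B) (f := fun g => g ^ 5)
    have hAB := Finset.card_union_le A B
    have hu := Finset.card_union_le ((A ∪ B).image (· ^ 1)) ((A ∪ B).image (· ^ 3))
    have hu' := Finset.card_union_le ((A ∪ B).image (· ^ 1) ∪ (A ∪ B).image (· ^ 3))
      (B.image (· ^ 5))
    rw [← hbad] at hu'
    omega
  have hJ (c : ℤ) (x : MonoidAlgebra ℤ H)
      (hx : x * powSum 1 univ = (c : MonoidAlgebra ℤ H) * powSum 1 univ) :
      ∑ g, x.coeff g = c := by
    rw [sum_coeff, hx, coeff_intCast_mul, coeff_powSum_one_univ, mul_one]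
  have hzsum : ∑ g, z.coeff g = 2 * n + 1 := hJ _ _ <| by
    push_cast
    linear_combination (powSum 2 A + powSum 2 B) * (hrel.right_mul - hrel.left_mul) + hrel.c₂_mul
  have hvsum : ∑ g, v.coeff g = (2 * n + 1) * (n + 1) := hJ _ _ <| by
    push_cast
    linear_combination (powSum 4 A + powSum 4 B) * hrel.right_mul
      + (((n : ℤ) : MonoidAlgebra ℤ H) + 1) * hrel.c₄_mul
  have hsq := h.sum_sq_coeff_le (by omega) hA hB hinj hAinv hBinv
  rw [← hz] at hsq
  have hsum := Finset.sum_le_sum fun g (_ : g ∈ univ) => hpoint g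
  simp only [Finset.sum_add_distrib, Finset.sum_sub_distrib, ← Finset.mul_sum, Finset.sum_const,
    Finset.card_univ, hcard, hzsum, hvsum, Finset.sum_ite_mem, Finset.univ_inter, nsmul_eq_mul,
    mul_one] at hsum
  have hn' : (23 : ℤ) ≤ n := by exact_mod_cast hn
  push_cast at hsum
  nlinarith

end IsPair

lemma ncard_mul_eq (S T : Set H) (h : H) :
    ({p : H × H | p.1 ∈ S ∧ p.2 ∈ T ∧ p.1 * p.2 = h}.ncard : ℤ)
      = (powSum 1 S.toFinset * powSum 1 T.toFinset).coeff h := by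
  rw [coeff_powSum_mul, ← Set.ncard_coe_finset]
  congr 2
  ext
  simp [and_assoc]

lemma ncard_sq_eq (S : Set H) (h : H) :
    ({t : H | t ∈ S ∧ t ^ 2 = h}.ncard : ℤ) = (powSum 2 S.toFinset).coeff h := by
  rw [coeff_powSum, ← Set.ncard_coe_finset]
  congr 2
  ext
  simp

lemma isPair_of_APLLEqs {n : ℕ} {T₀ T₁ : Set H} (h : APLLEqs n T₀ T₁) :
    IsPair n T₀.toFinset T₁.toFinset where
  mul_eq := by
    ext g
    have := h.1 g
    zify at this
    rw [ncard_mul_eq] at this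
    rw [this, ← Int.cast_one (R := MonoidAlgebra ℤ H), MonoidAlgebra.coeff_sub,
      Finsupp.sub_apply, coeff_intCast,
      coeff_powSum_one_univ]
    split_ifs <;> simp
  sq_add_sq := by
    ext g
    have := h.2 g
    zify at this
    rw [ncard_mul_eq, ncard_mul_eq, ncard_sq_eq, ncard_sq_eq] at this
    have h2 : (2 : MonoidAlgebra ℤ H) = ((2 : ℤ) : MonoidAlgebra ℤ H) := by norm_cast
    simp only [MonoidAlgebra.coeff_add, MonoidAlgebra.coeff_sub, Finsupp.add_apply,
      Finsupp.sub_apply, sq, h2, coeff_intCast_mul, coeff_intCast, coeff_powSum_one_univ]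
    split_ifs at this ⊢ <;> linarith

end Group

end APLL

/-- Nonexistence of inverse-closed subsets `T₀, T₁` with `e ∈ T₀` satisfying the
APLL group-ring equations, in any finite abelian group of order `n²+n+1`. -/
theorem no_APLL_subsets_odd_ge207_1mod5_2mod3 (n : ℕ) (hn : 0 < n)
    (hodd : Odd n) (hge : 207 ≤ n) (h5 : n % 5 = 1) (h3 : n % 3 = 2)
    (H : Type*) [CommGroup H] [Fintype H]
    (hcard : Fintype.card H = n ^ 2 + n + 1) :
    ¬ ∃ T₀ T₁ : Set H,
        T₀⁻¹ = T₀ ∧ T₁⁻¹ = T₁ ∧ (1 : H) ∈ T₀ ∧ APLLEqs n T₀ T₁ := by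
  rintro ⟨T₀, T₁, hT₀, hT₁, -, h⟩
  have hinv {T : Set H} (hT : T⁻¹ = T) : ∀ g ∈ T.toFinset, g⁻¹ ∈ T.toFinset := fun g hg => by
    rw [Set.mem_toFinset] at hg ⊢
    rwa [← Set.mem_inv, hT]
  have hinj : Function.Injective (fun g : H => g ^ 2) := by
    refine (Nat.Coprime.pow_left_bijective ?_).injective
    rw [Nat.card_eq_fintype_card, hcard, Nat.coprime_two_right]
    exact (by simpa [sq, mul_add] using Nat.even_mul_succ_self n : Even (n ^ 2 + n)).add_one
  have hpair := APLL.isPair_of_APLLEqs h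
  rcases hpair.card_eq hcard with ⟨h₀, h₁⟩ | ⟨h₁, h₀⟩
  · exact hpair.mod_five_ne_one hcard (by omega) h₀ h₁ hinj (hinv hT₀) (hinv hT₁) h5
  · exact hpair.symm.mod_five_ne_one hcard (by omega) h₁ h₀ hinj (hinv hT₁) (hinv hT₀) h5
end

section
/- Let n be a positive integer with n ≥ 186, n ≡ 1 (mod 5) and n ≡ 1 (mod 6). Then for every finite abelian group H of order n²+n+1 there exist no inverse-closed subsets T₀, T₁ of H with e ∈ T₀ satisfying the APLL group-ring equations. -/
open scoped Classical Pointwise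

namespace APLL

open Finset MonoidAlgebra

section GroupRing

variable {H : Type*}

/-- The element-sum of a finite subset in the integral group ring. -/
noncomputable def elemSum (A : Finset H) : MonoidAlgebra ℤ H := ∑ g ∈ A, single g 1

lemma coeff_sum_single {ι : Type*} (s : Finset ι) (f : ι → H) (h : H) :
    (∑ i ∈ s, single (f i) (1 : ℤ)).coeff h = ((s.filter fun i => f i = h).card : ℤ) := by
  simp [coeff_sum, Finsupp.finsetSum_apply, Finsupp.single_apply]

lemma coeff_sum_single_nonneg {ι : Type*} (s : Finset ι) (f : ι → H) (h : H) :
    0 ≤ (∑ i ∈ s, single (f i) (1 : ℤ)).coeff h := by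
  rw [coeff_sum_single]; positivity

lemma coeff_elemSum_eq_zero {A : Finset H} {h : H} (hh : h ∉ A) :
    (elemSum A).coeff h = 0 := by
  rw [elemSum, coeff_sum_single]
  simp only [Nat.cast_eq_zero, card_eq_zero, filter_eq_empty_iff]
  rintro g hg rfl
  exact hh hg

lemma coeff_elemSum_univ [Fintype H] (h : H) : (elemSum (univ : Finset H)).coeff h = 1 := by
  simp [elemSum]

variable [CommGroup H]

/-- The ring endomorphism of the group ring induced by `g ↦ g ^ t`. -/
noncomputable def power (t : ℕ) : MonoidAlgebra ℤ H →+* MonoidAlgebra ℤ H :=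
  mapDomainRingHom ℤ (powMonoidHom t)

/-- The ring endomorphism of the group ring induced by `g ↦ g⁻¹`. -/
noncomputable def reflect : MonoidAlgebra ℤ H →+* MonoidAlgebra ℤ H :=
  mapDomainRingHom ℤ (invMonoidHom : H →* H)

lemma power_elemSum (t : ℕ) (A : Finset H) :
    power t (elemSum A) = ∑ g ∈ A, single (g ^ t) 1 := by
  simp [power, elemSum]

lemma coeff_power_elemSum_eq_zero {t : ℕ} {A : Finset H} {h : H}
    (hh : h ∉ A.image (· ^ t)) : (power t (elemSum A)).coeff h = 0 := by
  rw [power_elemSum, coeff_sum_single]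
  simp only [mem_image, not_exists, not_and] at hh
  simpa [filter_eq_empty_iff] using hh

lemma power_power (s t : ℕ) (z : MonoidAlgebra ℤ H) :
    power s (power t z) = power (t * s) z := by
  have : (power s).comp (power t) = power (H := H) (t * s) := by
    rw [power, power, power, ← mapDomainRingHom_comp]
    congr 1
    ext g
    simp [pow_mul]
  exact congrArg (fun F => F z) this

lemma reflect_power (t : ℕ) (z : MonoidAlgebra ℤ H) :
    reflect (power t z) = power t (reflect z) := by
  have : reflect.comp (power t) = (power t).comp (reflect (H := H)) := by
    rw [power, reflect, ← mapDomainRingHom_comp, ← mapDomainRingHom_comp]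
    congr 1
    ext g
    simp
  exact congrArg (fun F => F z) this

lemma reflect_elemSum {A : Finset H} (hA : ∀ g ∈ A, g⁻¹ ∈ A) :
    reflect (elemSum A) = elemSum A := by
  simp only [reflect, elemSum, map_sum, mapDomainRingHom_apply, mapDomain_single]
  exact sum_nbij' (·⁻¹) (·⁻¹) hA hA (by simp) (by simp) (by simp)

lemma elemSum_mul_elemSum (A B : Finset H) :
    elemSum A * elemSum B = ∑ p ∈ A ×ˢ B, single (p.1 * p.2) 1 := by
  simp [elemSum, sum_mul_sum, sum_product]

lemma coeff_elemSum_mul_elemSum (A B : Set H) [Fintype H] (h : H) :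
    (elemSum A.toFinset * elemSum B.toFinset).coeff h
      = ({p : H × H | p.1 ∈ A ∧ p.2 ∈ B ∧ p.1 * p.2 = h}.ncard : ℤ) := by
  rw [elemSum_mul_elemSum, coeff_sum_single, Set.ncard_eq_toFinset_card']
  congr 2
  ext p
  simp [and_assoc]

lemma coeff_power_elemSum (A : Set H) [Fintype H] (t : ℕ) (h : H) :
    (power t (elemSum A.toFinset)).coeff h = ({g : H | g ∈ A ∧ g ^ t = h}.ncard : ℤ) := by
  rw [power_elemSum, coeff_sum_single, Set.ncard_eq_toFinset_card']
  congr 2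
  ext p
  simp

lemma exists_elemSum_pow_prime (A : Finset H) {p : ℕ} (hp : p.Prime) :
    ∃ z : MonoidAlgebra ℤ H, elemSum A ^ p = power p (elemSum A) + (p : ℤ) • z := by
  rw [power_elemSum, elemSum]
  induction A using Finset.induction_on with
  | empty => exact ⟨0, by simp [hp.ne_zero]⟩
  | insert a s ha ih =>
    obtain ⟨z, hz⟩ := ih
    obtain ⟨r, hr⟩ := exists_add_pow_prime_eq hp (single a (1 : ℤ)) (∑ g ∈ s, single g (1 : ℤ))
    refine ⟨z + single a 1 * (∑ g ∈ s, single g 1) * r, ?_⟩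
    rw [sum_insert ha, sum_insert ha, hr, hz, single_pow]
    simp only [zsmul_eq_mul, one_pow]
    push_cast
    ring

lemma coeff_power_add_nonneg (A B : Finset H) (t : ℕ) (h : H) :
    0 ≤ (power t (elemSum B + elemSum A)).coeff h := by
  rw [map_add, power_elemSum, power_elemSum, coeff_add, Finsupp.add_apply]
  exact add_nonneg (coeff_sum_single_nonneg _ _ _) (coeff_sum_single_nonneg _ _ _)

lemma coeff_power_add_mul_nonneg (A B : Finset H) (t : ℕ) (h : H) :
    0 ≤ (power t (elemSum B + elemSum A) * elemSum B).coeff h := by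
  rw [map_add, add_mul, power_elemSum, power_elemSum, elemSum, coeff_add, Finsupp.add_apply]
  simp only [sum_mul_sum, single_mul_single, mul_one, ← sum_product']
  exact add_nonneg (coeff_sum_single_nonneg _ _ _) (coeff_sum_single_nonneg _ _ _)

variable [Fintype H]

lemma elemSum_univ_mul_sum_single {ι : Type*} (s : Finset ι) (f : ι → H) :
    elemSum univ * ∑ i ∈ s, single (f i) (1 : ℤ) = (s.card : ℤ) • elemSum univ := by
  have key (g : H) : elemSum univ * single g (1 : ℤ) = elemSum univ := by
    simp only [elemSum, sum_mul, single_mul_single, mul_one]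
    exact Fintype.sum_bijective (· * g) (Group.mulRight_bijective g) _ _ fun _ => rfl
  simp [mul_sum, key]

lemma elemSum_univ_mul (A : Finset H) :
    elemSum univ * elemSum A = (A.card : ℤ) • elemSum univ :=
  elemSum_univ_mul_sum_single A id

lemma coeff_mul_one_s18 (z w : MonoidAlgebra ℤ H) :
    (z * w).coeff 1 = ∑ g, z.coeff g * w.coeff g⁻¹ := by
  rw [coeff_mul, Finsupp.sum_fintype _ _ (by simp)]
  refine sum_congr rfl fun g _ => ?_
  rw [Finsupp.sum_fintype _ _ (by simp)]
  simp [mul_eq_one_iff_inv_eq]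

lemma coeff_mul_self_one {z : MonoidAlgebra ℤ H} (hz : reflect z = z) :
    (z * z).coeff 1 = ∑ g, z.coeff g ^ 2 := by
  rw [coeff_mul_one_s18]
  refine sum_congr rfl fun g _ => ?_
  have : z.coeff g⁻¹ = z.coeff g := by
    conv_lhs => rw [← hz]
    exact Finsupp.mapDomain_apply inv_injective _ _
  rw [this, sq]

lemma sum_coeff_s18 (z : MonoidAlgebra ℤ H) :
    ∑ g, z.coeff g = (elemSum univ * z).coeff 1 := by
  rw [mul_comm, coeff_mul_one_s18]
  simp [coeff_elemSum_univ]

lemma power_elemSum_univ {t : ℕ} (ht : (Nat.card H).Coprime t) :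
    power t (elemSum (univ : Finset H)) = elemSum univ := by
  rw [power_elemSum, elemSum]
  exact Fintype.sum_bijective _ (powCoprime ht).bijective _ _ fun _ => rfl

lemma power_two_square_formula {t : ℕ} (hco : (Nat.card H).Coprime 2) (n : ℕ) (z : MonoidAlgebra ℤ H) :
    power 2 (4 * elemSum univ - power t z + (2 * (n : MonoidAlgebra ℤ H) - 2))
      = 4 * elemSum univ - power (t * 2) z + (2 * (n : MonoidAlgebra ℤ H) - 2) := by
  rw [map_add, map_sub, map_sub, map_mul, map_mul, power_power, power_elemSum_univ hco,
    map_natCast, map_ofNat, map_ofNat]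

end GroupRing

/-- In an abelian group of odd order, an inverse-closed set avoiding the identity has even size. -/
lemma even_card_of_inv_mem {H : Type*} [CommGroup H] [Fintype H] (hH : (Nat.card H).Coprime 2)
    {A : Finset H} (hA : ∀ g ∈ A, g⁻¹ ∈ A) (h1 : (1 : H) ∉ A) : Even A.card := by
  have hsum : ∑ _g ∈ A, (1 : ZMod 2) = 0 := by
    refine sum_involution (fun g _ => g⁻¹) (fun _ _ => by decide) ?_ hA (fun _ _ => inv_inv _)
    intro g hg _ hgg
    have : g ^ 2 = 1 ^ 2 := by rw [sq, one_pow]; nth_rw 1 [← hgg]; exact inv_mul_cancel g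
    exact h1 ((powCoprime hH).injective this ▸ hg)
  rw [even_iff_two_dvd, ← CharP.cast_eq_zero_iff (ZMod 2) 2]
  simpa using hsum

/-- The sizes of the two subsets, from the augmentations of the two equations. -/
lemma card_eq_of_card_equations {n a b : ℕ} (hn : n % 2 = 1) (hb : Even b)
    (hab : a * b = n ^ 2 + n)
    (hsq : a ^ 2 + b ^ 2 + a + b = 2 * (n ^ 2 + n + 1) + 2 * n) : a = n ∧ b = n + 1 := by
  have hs : a + b = 2 * n + 1 := by
    have : (a + b) * (a + b + 1) = (2 * n + 1) * (2 * n + 1 + 1) := by nlinarith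
    rcases lt_trichotomy (a + b) (2 * n + 1) with h | h | h
    · nlinarith
    · exact h
    · nlinarith
  obtain ⟨c, rfl⟩ := hb
  have ha : a = 2 * n + 1 - (c + c) := by omega
  have hz : ((c + c : ℕ) - n : ℤ) * ((c + c : ℕ) - (n + 1)) = 0 := by
    zify at hab hs
    push_cast
    have : (a : ℤ) = 2 * n + 1 - (c + c) := by linarith
    rw [this] at hab
    linear_combination -hab
  rcases mul_eq_zero.mp hz with h | h <;> omega

section Relations

variable {R : Type*} [CommRing R] {n N x y K P S : R}

lemma fourth_mul_eq (hxy : x * y = K - 1) (hsq : x ^ 2 + y ^ 2 = 2 * K + 2 * n - P)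
    (hPP : P * P = 4 * K - S + (2 * n - 2)) (hKx : K * x = (n + 1) * K) (hKy : K * y = n * K)
    (hKP : K * P = (2 * n + 1) * K) :
    S * x = (4 * (n + 1) - (n + 2) * (2 * n + 1) + (n + 2) * (n + 1) ^ 2 + 2 * n * (n + 2)
        + (n + 1)) * K + (4 * n ^ 2 + 2 * n - 3) * x + 2 * n * y - 4 * n * (P * x) - P * y
        - x ^ 5 := by
  have hA : P * x = (n + 2) * K + 2 * n * x + y - x ^ 3 := by
    linear_combination x * hsq - y * hxy + 2 * hKx - hKy
  have hAxx : P * x * x ^ 2 = (n + 2) * (n + 1) ^ 2 * K + 2 * n * x ^ 3 + (n + 1) * K - x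
      - x ^ 5 := by
    linear_combination x ^ 2 * hA + x * hxy + ((n + 2) * (x + (n + 1)) + 1) * hKx
  have hPA : P * (P * x) = (n + 2) * (2 * n + 1) * K + 2 * n * (P * x) + P * y
      - P * x * x ^ 2 := by
    linear_combination P * hA + (n + 2) * hKP
  linear_combination x * hPP + 4 * hKx - hPA + hAxx + 2 * n * hA

lemma second_mul_sub_eq (hxy : x * y = K - 1) (hsq : x ^ 2 + y ^ 2 = 2 * K + 2 * n - P)
    (hKx : K * x = (n + 1) * K) (hKy : K * y = n * K) :
    P * (x - y) = 3 * K + (2 * n - 1) * (x - y) - x ^ 3 + y ^ 3 := by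
  linear_combination (x - y) * hsq + (x - y) * hxy + 3 * hKx - 3 * hKy

lemma second_mul_sub_mul_self (hxy : x * y = K - 1)
    (hsq : x ^ 2 + y ^ 2 = 2 * K + 2 * n - P) (hPP : P * P = 4 * K - S + (2 * n - 2))
    (hKP : K * P = (2 * n + 1) * K) :
    P * (x - y) * (P * (x - y))
      = 4 * K - (2 * n + 2) * S + S * P + (4 * n ^ 2 - 4) - (2 * n - 2) * P := by
  linear_combination P ^ 2 * (hsq - 2 * hxy) + (2 * n + 2 - P) * hPP - 4 * hKP

end Relations

section Count

variable {H : Type*} [CommGroup H] [Fintype H]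

/-- The two APLL equations for inverse-closed `A = T₀` and `B = T₁`, in the integral group ring. -/
structure GroupRingEqs (n : ℕ) (A B : Finset H) : Prop where
  inv_mem_left : ∀ g ∈ A, g⁻¹ ∈ A
  inv_mem_right : ∀ g ∈ B, g⁻¹ ∈ B
  mul_eq : elemSum B * elemSum A = elemSum univ - 1
  sq_add_sq : elemSum B ^ 2 + elemSum A ^ 2
    = 2 * elemSum univ + 2 * (n : MonoidAlgebra ℤ H) - power 2 (elemSum B + elemSum A)

lemma GroupRingEqs.of_APLLEqs {n : ℕ} {T₀ T₁ : Set H} (hT₀ : T₀⁻¹ = T₀) (hT₁ : T₁⁻¹ = T₁)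
    (hT : APLLEqs n T₀ T₁) : GroupRingEqs n T₀.toFinset T₁.toFinset where
  inv_mem_left g hg := by
    rw [Set.mem_toFinset] at hg ⊢
    rwa [← Set.mem_inv, hT₀]
  inv_mem_right g hg := by
    rw [Set.mem_toFinset] at hg ⊢
    rwa [← Set.mem_inv, hT₁]
  mul_eq := by
    ext h
    rw [mul_comm, coeff_elemSum_mul_elemSum, hT.1 h]
    by_cases h1 : h = 1
    · subst h1; simp [coeff_elemSum_univ]
    · simp [coeff_elemSum_univ, h1, one_def]
  sq_add_sq := by
    have : elemSum T₀.toFinset * elemSum T₀.toFinset + elemSum T₁.toFinset * elemSum T₁.toFinset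
        + power 2 (elemSum T₀.toFinset) + power 2 (elemSum T₁.toFinset)
        = (2 : ℤ) • elemSum univ + (2 * n : ℤ) • 1 := by
      ext h
      simp only [coeff_add, Finsupp.add_apply, coeff_elemSum_mul_elemSum,
        coeff_power_elemSum, coeff_smul_apply, coeff_elemSum_univ]
      rw [show ∀ a b c d : ℕ, (a : ℤ) + b + c + d = (a + b + c + d : ℕ) by intros; push_cast; rfl,
        hT.2 h]
      by_cases h1 : h = 1
      · subst h1; simp
      · simp [h1, one_def]
    rw [map_add]
    simp only [zsmul_eq_mul, Int.cast_mul, Int.cast_ofNat, Int.cast_natCast, mul_one] at this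
    linear_combination this

namespace GroupRingEqs

variable {n : ℕ} {A B : Finset H}

lemma second_mul_second (hT : GroupRingEqs n A B) (hco : (Nat.card H).Coprime 2) :
    power 2 (elemSum B + elemSum A) * power 2 (elemSum B + elemSum A)
      = 4 * elemSum univ - power 4 (elemSum B + elemSum A) + (2 * (n : MonoidAlgebra ℤ H) - 2) := by
  have h : (elemSum B + elemSum A) * (elemSum B + elemSum A)
      = 4 * elemSum univ - power 2 (elemSum B + elemSum A) + (2 * (n : MonoidAlgebra ℤ H) - 2) := by
    linear_combination hT.sq_add_sq + 2 * hT.mul_eq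
  have := congrArg (power 2) h
  rwa [map_mul, power_two_square_formula hco] at this

lemma univ_mul_power (A B : Finset H) {t : ℕ} (hco : (Nat.card H).Coprime t) :
    elemSum univ * power t (elemSum B + elemSum A)
      = ((B.card + A.card : ℕ) : MonoidAlgebra ℤ H) * elemSum univ := by
  have h : elemSum univ * (elemSum B + elemSum A)
      = ((B.card + A.card : ℕ) : MonoidAlgebra ℤ H) * elemSum univ := by
    rw [mul_add, elemSum_univ_mul, elemSum_univ_mul, ← add_smul, zsmul_eq_mul]
    push_cast; rfl
  have := congrArg (power t) h
  rwa [map_mul, map_mul, power_elemSum_univ hco, map_natCast] at this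

lemma card_eq (hT : GroupRingEqs n A B) (hco : (Nat.card H).Coprime 2) (hn : n % 2 = 1)
    (hcard : Fintype.card H = n ^ 2 + n + 1) (h1 : (1 : H) ∉ B) :
    A.card = n ∧ B.card = n + 1 := by
  have hcoe {c d : ℤ} (h : c • elemSum (univ : Finset H) = d • elemSum univ) : c = d := by
    have := congrArg (fun z => z.coeff 1) h
    simpa only [coeff_smul_apply, coeff_elemSum_univ, smul_eq_mul, mul_one] using this
  have hKK : elemSum univ * elemSum univ
      = (((n ^ 2 + n + 1 : ℕ) : ℤ) : MonoidAlgebra ℤ H) * elemSum univ := by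
    rw [elemSum_univ_mul, card_univ, hcard, zsmul_eq_mul]
  have hKx := elemSum_univ_mul B
  have hKy := elemSum_univ_mul A
  have hKP := univ_mul_power A B hco
  rw [zsmul_eq_mul] at hKx hKy
  push_cast at hKK hKx hKy hKP
  refine card_eq_of_card_equations hn (even_card_of_inv_mem hco hT.inv_mem_right h1) ?_ ?_
  · zify
    refine hcoe ?_
    simp only [zsmul_eq_mul]
    push_cast
    linear_combination -(A.card : MonoidAlgebra ℤ H) * hKx - elemSum B * hKy
      + elemSum univ * hT.mul_eq + hKK
  · zify
    refine hcoe ?_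
    simp only [zsmul_eq_mul]
    push_cast
    linear_combination -((B.card : MonoidAlgebra ℤ H) + elemSum B) * hKx
      - ((A.card : MonoidAlgebra ℤ H) + elemSum A) * hKy - hKP
      + elemSum univ * hT.sq_add_sq + 2 * hKK

lemma reflect_power_add (hT : GroupRingEqs n A B) (t : ℕ) :
    reflect (power t (elemSum B + elemSum A)) = power t (elemSum B + elemSum A) := by
  rw [reflect_power, map_add, reflect_elemSum hT.inv_mem_left, reflect_elemSum hT.inv_mem_right]

lemma sum_coeff_fourth_mul (hco : (Nat.card H).Coprime 2) (ha : A.card = n)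
    (hb : B.card = n + 1) :
    ∑ h, (power 4 (elemSum B + elemSum A) * elemSum B).coeff h = (2 * n + 1) * ((n : ℤ) + 1) := by
  have hKS := univ_mul_power A B (hco.mul_right hco)
  have hKx := elemSum_univ_mul B
  have : elemSum univ * (power 4 (elemSum B + elemSum A) * elemSum B)
      = ((2 * n + 1) * (n + 1) : ℤ) • elemSum univ := by
    rw [zsmul_eq_mul] at hKx ⊢
    rw [ha, hb] at hKS
    rw [hb] at hKx
    push_cast at hKS hKx ⊢
    linear_combination elemSum B * hKS + (2 * (n : MonoidAlgebra ℤ H) + 1) * hKx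
  rw [sum_coeff_s18, this, coeff_smul_apply, coeff_elemSum_univ, smul_eq_mul, mul_one]

lemma sum_coeff_second_mul_sub_sq_le (hT : GroupRingEqs n A B) (hco : (Nat.card H).Coprime 2)
    (hn : 1 ≤ n) (ha : A.card = n) (hb : B.card = n + 1) :
    ∑ h, (power 2 (elemSum B + elemSum A) * (elemSum B - elemSum A)).coeff h ^ 2
      ≤ 4 * (n : ℤ) ^ 2 + 2 * n + 2 := by
  have hPP := hT.second_mul_second hco
  have hSS := congrArg (power 2) hPP
  rw [map_mul, power_power, power_two_square_formula hco] at hSS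
  have hKP := univ_mul_power A B hco
  rw [ha, hb] at hKP
  push_cast at hKP
  have hP1 := coeff_power_add_nonneg A B 2 1
  have hS1 := coeff_power_add_nonneg A B 4 1
  have hQ1 := coeff_power_add_nonneg A B (4 * 2) 1
  have hrP := hT.reflect_power_add 2
  have hrS := hT.reflect_power_add 4
  have hsq := hT.sq_add_sq
  change power 4 (elemSum B + elemSum A) * power 4 (elemSum B + elemSum A) = _ at hSS
  generalize power 2 (elemSum B + elemSum A) = P at *
  generalize power 4 (elemSum B + elemSum A) = S at *
  generalize power (4 * 2) (elemSum B + elemSum A) = Q at *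
  have hrU : reflect (P * (elemSum B - elemSum A)) = P * (elemSum B - elemSum A) := by
    rw [map_mul, map_sub, hrP, reflect_elemSum hT.inv_mem_left, reflect_elemSum hT.inv_mem_right]
  have hUU : P * (elemSum B - elemSum A) * (P * (elemSum B - elemSum A))
      = (4 : ℤ) • elemSum univ - (2 * n + 2 : ℤ) • S + S * P + (4 * n ^ 2 - 4 : ℤ) • 1
        - (2 * n - 2 : ℤ) • P := by
    rw [second_mul_sub_mul_self hT.mul_eq hsq hPP (by linear_combination hKP)]
    simp only [zsmul_eq_mul]; push_cast
    ring
  have hSP : (S - P) * (S - P) + (2 : ℤ) • (S * P) + Q + S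
      = (8 : ℤ) • elemSum univ + (4 * n - 4 : ℤ) • 1 := by
    simp only [zsmul_eq_mul]; push_cast
    linear_combination hPP + hSS
  have hSPone := congrArg (fun z => z.coeff 1) hSP
  have hSP0 : 0 ≤ ((S - P) * (S - P)).coeff 1 := by
    rw [coeff_mul_self_one (by rw [map_sub, hrS, hrP])]
    positivity
  rw [← coeff_mul_self_one hrU, hUU]
  simp only [coeff_add, coeff_sub, Finsupp.add_apply, Finsupp.sub_apply, coeff_smul_apply,
    smul_eq_mul, coeff_one_one, coeff_elemSum_univ] at hSPone ⊢
  have hn' : (1 : ℤ) ≤ n := by exact_mod_cast hn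
  nlinarith [mul_nonneg (by linarith : (0 : ℤ) ≤ 2 * n - 2) hP1,
    mul_nonneg (by linarith : (0 : ℤ) ≤ 2 * n + 2) hS1]

lemma three_dvd_coeff (hT : GroupRingEqs n A B) (ha : A.card = n) (hb : B.card = n + 1) {h : H}
    (hA : h ∉ A) (hB : h ∉ B) (hA3 : h ∉ A.image (· ^ 3)) (hB3 : h ∉ B.image (· ^ 3)) :
    3 ∣ (power 2 (elemSum B + elemSum A) * (elemSum B - elemSum A)).coeff h := by
  obtain ⟨z, hz⟩ := exists_elemSum_pow_prime A Nat.prime_three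
  obtain ⟨w, hw⟩ := exists_elemSum_pow_prime B Nat.prime_three
  have hKx := elemSum_univ_mul B
  have hKy := elemSum_univ_mul A
  rw [zsmul_eq_mul, ha] at hKy
  rw [zsmul_eq_mul, hb] at hKx
  push_cast at hKx hKy
  have hU : power 2 (elemSum B + elemSum A) * (elemSum B - elemSum A)
      = (3 : ℤ) • (elemSum univ + z - w) + (2 * n - 1 : ℤ) • (elemSum B - elemSum A)
        - power 3 (elemSum B) + power 3 (elemSum A) := by
    rw [second_mul_sub_eq hT.mul_eq hT.sq_add_sq hKx hKy, hz, hw]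
    simp only [zsmul_eq_mul]; push_cast; ring
  rw [hU]
  simp only [coeff_add, coeff_sub, Finsupp.add_apply, Finsupp.sub_apply, coeff_smul_apply,
    smul_eq_mul, coeff_power_elemSum_eq_zero hA3, coeff_power_elemSum_eq_zero hB3,
    coeff_elemSum_eq_zero hA, coeff_elemSum_eq_zero hB, sub_zero, mul_zero, add_zero]
  exact dvd_mul_right _ _

lemma five_dvd_coeff (hT : GroupRingEqs n A B) (hco : (Nat.card H).Coprime 2) (h5 : n % 5 = 1)
    (ha : A.card = n) (hb : B.card = n + 1) {h : H} (hA : h ∉ A) (hB : h ∉ B)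
    (hB5 : h ∉ B.image (· ^ 5)) :
    5 ∣ (power 4 (elemSum B + elemSum A) * elemSum B).coeff h
      - (power 2 (elemSum B + elemSum A) * (elemSum B - elemSum A)).coeff h + 1 := by
  obtain ⟨z, hz⟩ := exists_elemSum_pow_prime B Nat.prime_five
  obtain ⟨q, rfl⟩ : ∃ q, n = 5 * q + 1 := ⟨n / 5, by omega⟩
  have hKx := elemSum_univ_mul B
  have hKy := elemSum_univ_mul A
  have hKP := univ_mul_power A B hco
  rw [zsmul_eq_mul, ha] at hKy
  rw [zsmul_eq_mul, hb] at hKx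
  rw [ha, hb] at hKP
  have hPP := hT.second_mul_second hco
  have hsq := hT.sq_add_sq
  set P := power 2 (elemSum B + elemSum A)
  set S := power 4 (elemSum B + elemSum A)
  have hV := fourth_mul_eq (n := ((5 * q + 1 : ℕ) : MonoidAlgebra ℤ H)) hT.mul_eq hsq hPP
    (by push_cast at hKx ⊢; exact hKx) (by push_cast at hKy ⊢; exact hKy)
    (by push_cast at hKP ⊢; linear_combination hKP)
  have hVU : S * elemSum B - P * (elemSum B - elemSum A) + elemSum univ
      = (5 : ℤ) • ((25 * q ^ 3 + 35 * q ^ 2 + 20 * q + 4 : ℤ) • elemSum univ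
          - (4 * q + 1 : ℤ) • (P * elemSum B) - z)
        + (4 * (5 * q + 1) ^ 2 + 2 * (5 * q + 1) - 3 : ℤ) • elemSum B
        + (2 * (5 * q + 1) : ℤ) • elemSum A - power 5 (elemSum B) := by
    rw [hV, hz]
    simp only [zsmul_eq_mul]; push_cast; ring
  have hVUh := congrArg (fun w => w.coeff h) hVU
  simp only [coeff_add, coeff_sub (R := ℤ), Finsupp.add_apply, Finsupp.sub_apply,
    coeff_smul_apply, smul_eq_mul, coeff_power_elemSum_eq_zero hB5, coeff_elemSum_univ,
    coeff_elemSum_eq_zero hA, coeff_elemSum_eq_zero hB, sub_zero, mul_zero, add_zero] at hVUh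
  rw [hVUh]
  exact dvd_mul_right _ _

lemma le_thirty (hT : GroupRingEqs n A B) (hco : (Nat.card H).Coprime 2) (hn : n % 2 = 1)
    (h5 : n % 5 = 1) (hcard : Fintype.card H = n ^ 2 + n + 1) (h1 : (1 : H) ∉ B) : n ≤ 30 := by
  obtain ⟨ha, hb⟩ := hT.card_eq hco hn hcard h1
  have hVsum := sum_coeff_fourth_mul hco ha hb
  have hUsum := hT.sum_coeff_second_mul_sub_sq_le hco (by omega) ha hb
  have hVnonneg := coeff_power_add_mul_nonneg A B 4
  have h3dvd := @three_dvd_coeff _ _ _ _ _ _ hT ha hb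
  have h5dvd := @five_dvd_coeff _ _ _ _ _ _ hT hco h5 ha hb
  generalize power 4 (elemSum B + elemSum A) * elemSum B = V at *
  generalize power 2 (elemSum B + elemSum A) * (elemSum B - elemSum A) = U at *
  set E : Finset H := A ∪ B ∪ A.image (· ^ 3) ∪ B.image (· ^ 3) ∪ B.image (· ^ 5) with hE
  have hEcard : (E.card : ℤ) ≤ 5 * n + 3 := by
    have : E.card ≤ A.card + B.card + A.card + B.card + B.card :=
      (card_union_le _ _).trans <| add_le_add ((card_union_le _ _).trans <| add_le_add
        ((card_union_le _ _).trans <| add_le_add (card_union_le _ _) card_image_le)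
        card_image_le) card_image_le
    omega
  have hlocal (h : H) (hh : h ∉ E) : 12 ≤ 3 * V.coeff h + U.coeff h ^ 2 := by
    simp only [hE, mem_union, not_or] at hh
    obtain ⟨⟨⟨⟨hhA, hhB⟩, hhA3⟩, hhB3⟩, hhB5⟩ := hh
    obtain ⟨k, hk⟩ := h3dvd hhA hhB hhA3 hhB3
    have hm := h5dvd hhA hhB hhB5
    have hV0 := hVnonneg h
    have hcases : k = 0 ∨ k = 1 ∨ k = -1 ∨ 2 ≤ k ∨ k ≤ -2 := by omega
    rcases hcases with rfl | rfl | rfl | hk2 | hk2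
    · rw [hk] at hm ⊢; omega
    · rw [hk] at hm ⊢; omega
    · rw [hk] at hm ⊢; omega
    · nlinarith
    · nlinarith
  have htotal : ∑ h : H, (12 - if h ∈ E then (12 : ℤ) else 0)
      ≤ ∑ h, (3 * V.coeff h + U.coeff h ^ 2) := by
    refine sum_le_sum fun h _ => ?_
    split_ifs with hh
    · nlinarith [hVnonneg h, sq_nonneg (U.coeff h)]
    · simpa using hlocal h hh
  have hleft : ∑ h : H, (12 - if h ∈ E then (12 : ℤ) else 0)
      = 12 * (n ^ 2 + n + 1) - 12 * E.card := by
    rw [sum_sub_distrib, sum_ite_mem, univ_inter, sum_const, sum_const, card_univ, hcard]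
    simp only [nsmul_eq_mul]
    push_cast
    ring
  rw [hleft, sum_add_distrib, ← mul_sum, hVsum] at htotal
  by_contra! hlt
  zify at hlt
  nlinarith

end GroupRingEqs

end Count

end APLL

/-- Nonexistence of inverse-closed subsets `T₀, T₁` with `e ∈ T₀` satisfying the
APLL group-ring equations, in any finite abelian group of order `n²+n+1`. -/
theorem no_APLL_subsets_ge186_1mod5_1mod6 (n : ℕ) (hn : 0 < n)
    (hge : 186 ≤ n) (h5 : n % 5 = 1) (h6 : n % 6 = 1)
    (H : Type*) [CommGroup H] [Fintype H]
    (hcard : Fintype.card H = n ^ 2 + n + 1) :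
    ¬ ∃ T₀ T₁ : Set H,
        T₀⁻¹ = T₀ ∧ T₁⁻¹ = T₁ ∧ (1 : H) ∈ T₀ ∧ APLLEqs n T₀ T₁ := by
  rintro ⟨T₀, T₁, hT₀, hT₁, h1, hT⟩
  have hco : (Nat.card H).Coprime 2 := by
    rw [Nat.card_eq_fintype_card, hcard, Nat.coprime_two_right, Nat.odd_iff]
    simp [Nat.add_mod, Nat.pow_mod, show n % 2 = 1 by omega]
  have h1T₁ : (1 : H) ∉ T₁.toFinset := by
    intro h
    have h0 := hT.1 1
    rw [if_pos rfl, Set.ncard_eq_zero] at h0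
    exact (h0.le ⟨h1, Set.mem_toFinset.mp h, one_mul 1⟩ : ((1 : H), (1 : H)) ∈ (∅ : Set (H × H)))
  have := (APLL.GroupRingEqs.of_APLLEqs hT₀ hT₁ hT).le_thirty hco (by omega) h5 hcard h1T₁
  omega
end
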